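/- arXiv:2511.03863 — 3 statements merged into one kernel-verified Lean document; each statement's English description precedes it below -/
import Mathlib

section
/- Let G be a brick that is not Birkhoff–von Neumann, and let x* be an extreme point of the bipartite relaxation P(G) that is not the incidence vector of a perfect matching. Then there exists an odd cut C = δ(U) of G such that Σ_{e ∈ C} x*_e < 1, every edge of G belongs to some perfect matching M with |M ∩ C| = 1, and the face F = {x ∈ PM(G) : Σ_{e ∈ C} x_e = 1} is nonempty with the dimension of its affine span equal to the dimension of the affine span of PM(G) minus 1. -/
open BigOperators

variable {V : Type*}

/-- A graph is matching covered if it is connected, has an edge, and every edge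
lies in some perfect matching. -/
def MatchingCovered (G : SimpleGraph V) : Prop :=
  G.Connected ∧ G.edgeSet.Nonempty ∧
    ∀ e ∈ G.edgeSet, ∃ M : G.Subgraph, M.IsPerfectMatching ∧ e ∈ M.edgeSet

/-- The cut `δ(U)`: edges of `G` with exactly one endpoint in `U`. -/
def cutSet (G : SimpleGraph V) (U : Set V) : Set (Sym2 V) :=
  {e | e ∈ G.edgeSet ∧ ∃ a b, e = s(a, b) ∧ a ∈ U ∧ b ∉ U}

/-- `U` is the shore of an odd cut: both `U` and its complement have odd size. -/
def IsOddCutShore [Fintype V] (U : Set V) : Prop := Odd U.ncard ∧ Odd Uᶜ.ncard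

/-- `δ(U)` is a tight cut: an odd cut met exactly once by every perfect matching. -/
def IsTightCut [Fintype V] (G : SimpleGraph V) (U : Set V) : Prop :=
  IsOddCutShore U ∧ ∀ M : G.Subgraph, M.IsPerfectMatching →
    (M.edgeSet ∩ cutSet G U).ncard = 1

/-- A brick: a non-bipartite matching covered graph with no nontrivial tight cut. -/
def IsBrick [Fintype V] (G : SimpleGraph V) : Prop :=
  MatchingCovered G ∧ ¬ G.Colorable 2 ∧
    ∀ U : Set V, IsTightCut G U → ¬(2 ≤ U.ncard ∧ 2 ≤ Uᶜ.ncard)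

open Classical in
/-- The incidence vector (over `ℝ`) of the edge set of a subgraph `M` of `G`. -/
noncomputable def incVecR (G : SimpleGraph V) (M : G.Subgraph) : Sym2 V → ℝ :=
  fun e => if e ∈ M.edgeSet then (1 : ℝ) else 0

/-- The perfect matching polytope: convex hull of incidence vectors of perfect
matchings. -/
def pmPolytope (G : SimpleGraph V) : Set (Sym2 V → ℝ) :=
  convexHull ℝ {x | ∃ M : G.Subgraph, M.IsPerfectMatching ∧ x = incVecR G M}

/-- The bipartite relaxation `P(G)`: nonnegative vectors supported on the edges
of `G` whose sum over the edges at each vertex is `1`. -/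
def bipRelaxation [Fintype V] [DecidableEq V] (G : SimpleGraph V) : Set (Sym2 V → ℝ) :=
  {x | (∀ e, 0 ≤ x e) ∧ (∀ e, e ∉ G.edgeSet → x e = 0) ∧
    ∀ v : V, ∑ e ∈ Finset.univ.filter (fun e : Sym2 V => v ∈ e), x e = 1}

/-- A matching covered graph is Birkhoff–von Neumann if its perfect matching
polytope equals its bipartite relaxation. -/
def IsBvN [Fintype V] [DecidableEq V] (G : SimpleGraph V) : Prop :=
  pmPolytope G = bipRelaxation G

/-- The dimension of the affine span of a subset of `ℝ^{Sym2 V}`. -/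
noncomputable def affDim (s : Set (Sym2 V → ℝ)) : ℕ :=
  Module.finrank ℝ (affineSpan ℝ s).direction

/-! ### Part A: involutions, exchange, and the tight constraint lemma -/

/-- Weight of the matching encoded by the involution `f`. -/
def invW [Fintype V] (w : V → V → ℝ) (f : V → V) : ℝ := ∑ i, w i (f i)

/-- Use `g` on `S` and `f` off `S`. -/
def splice [DecidableEq V] (f g : V → V) (S : Finset V) : V → V :=
  fun i => if i ∈ S then g i else f i

/-- `f` is a maximum weight involution. -/
def MaxInv [Fintype V] (w : V → V → ℝ) (f : V → V) : Prop :=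
  Function.Involutive f ∧ ∀ g, Function.Involutive g → invW w g ≤ invW w f

lemma splice_involutive [DecidableEq V] {f g : V → V} {S : Finset V}
    (hf : Function.Involutive f) (hg : Function.Involutive g)
    (hfS : ∀ i ∈ S, f i ∈ S) (hgS : ∀ i ∈ S, g i ∈ S) :
    Function.Involutive (splice f g S) := by
  intro i
  by_cases hi : i ∈ S
  · have := hgS i hi
    simp [splice, hi, this, hg i]
  · have : f i ∉ S := fun h => hi (by simpa [hf i] using hfS _ h)
    simp [splice, hi, this, hf i]

lemma invW_splice_add [Fintype V] [DecidableEq V] (w : V → V → ℝ) (f g : V → V)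
    (S : Finset V) :
    invW w (splice f g S) + invW w (splice g f S) = invW w f + invW w g := by
  simp only [invW, ← Finset.sum_add_distrib]
  refine Finset.sum_congr rfl fun i _ => ?_
  by_cases hi : i ∈ S <;> simp [splice, hi, add_comm]

lemma MaxInv.splice [Fintype V] [DecidableEq V] {w : V → V → ℝ} {f g : V → V}
    {S : Finset V} (hf : MaxInv w f) (hg : MaxInv w g)
    (hfS : ∀ i ∈ S, f i ∈ S) (hgS : ∀ i ∈ S, g i ∈ S) :
    MaxInv w (splice f g S) := by
  have h1 := splice_involutive hf.1 hg.1 hfS hgS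
  have h2 := splice_involutive hg.1 hf.1 hgS hfS
  refine ⟨h1, fun k hk => ?_⟩
  have e := invW_splice_add w f g S
  have := hg.2 _ h2
  have := hf.2 k hk
  linarith

lemma even_card_of_inv {T : Finset V} {f : V → V} (hf : Function.Involutive f)
    (hT : ∀ i ∈ T, f i ∈ T) (hne : ∀ i ∈ T, f i ≠ i) : Even T.card := by
  have : ∑ _x ∈ T, (1 : ZMod 2) = 0 :=
    Finset.sum_involution (fun a _ => f a) (fun _ _ => by decide) (fun a ha _ => hne a ha)
      (fun a ha => hT a ha) (fun a _ => hf a)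
  simp only [Finset.sum_const, nsmul_eq_mul, mul_one] at this
  exact (ZMod.natCast_eq_zero_iff_even).1 this

lemma orbit_exists [Fintype V] [DecidableEq V] {f g : V → V} (hf : Function.Involutive f)
    (hg : Function.Involutive g) {t : V} (ht : g t = t) :
    ∃ S : Finset V, t ∈ S ∧ (∀ i ∈ S, f i ∈ S) ∧ (∀ i ∈ S, g i ∈ S) ∧
      ∀ u ∈ S, ∀ v ∈ S, f u = u → f v = v → u = v := by
  classical
  set F : Equiv.Perm V := hf.toPerm with hF
  set K : Equiv.Perm V := hg.toPerm with hK
  have hFf : ∀ i, F i = f i := fun _ => rfl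
  have hKg : ∀ i, K i = g i := fun _ => rfl
  have hFi : F⁻¹ = F := by ext i; rw [Equiv.Perm.inv_eq_iff_eq]; simp [hFf, hf i]
  have hKi : K⁻¹ = K := by ext i; rw [Equiv.Perm.inv_eq_iff_eq]; simp [hKg, hg i]
  set r : Equiv.Perm V := F * K with hr
  have hconj : K * r * K⁻¹ = r⁻¹ := by
    rw [hr, mul_inv_rev, hFi, hKi, mul_assoc, mul_assoc]
    nth_rewrite 3 [← hKi]; simp
  have hKr : ∀ k : ℤ, g ((r ^ k) t) = (r ^ (-k)) t := by
    intro k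
    have h : (r⁻¹) ^ k = K * r ^ k * K⁻¹ := by rw [← hconj, conj_zpow]
    rw [zpow_neg, ← inv_zpow, h, hKi]
    simp [hKg, ht]
  have hFr : ∀ k : ℤ, f ((r ^ k) t) = (r ^ (1 - k)) t := by
    intro k
    have : F = r * K := by rw [hr, mul_assoc]; nth_rewrite 2 [← hKi]; simp
    rw [← hFf, this, Equiv.Perm.mul_apply, hKg, hKr, sub_eq_add_neg, zpow_add, zpow_one]
    rfl
  refine ⟨Finset.univ.filter (fun x => ∃ k : ℤ, (r ^ k) t = x), ?_, ?_, ?_, ?_⟩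
  · simp only [Finset.mem_filter, Finset.mem_univ, true_and]; exact ⟨0, by simp⟩
  · simp only [Finset.mem_filter, Finset.mem_univ, true_and]
    rintro _ ⟨k, rfl⟩; exact ⟨_, (hFr k).symm⟩
  · simp only [Finset.mem_filter, Finset.mem_univ, true_and]
    rintro _ ⟨k, rfl⟩; exact ⟨_, (hKr k).symm⟩
  · simp only [Finset.mem_filter, Finset.mem_univ, true_and]
    rintro _ ⟨k, rfl⟩ _ ⟨l, rfl⟩ h1 h2
    rw [hFr] at h1 h2
    have key : ∀ a b : ℤ, (r ^ a) t = (r ^ b) t → r ^ (a - b) ∈ MulAction.stabilizer (Equiv.Perm V) t := by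
      intro a b h
      rw [MulAction.mem_stabilizer_iff, Equiv.Perm.smul_def, sub_eq_neg_add, zpow_add,
        Equiv.Perm.mul_apply, h, ← Equiv.Perm.mul_apply, ← zpow_add]
      simp
    have m1 := key _ _ h1
    have m2 := key _ _ h2
    have m3 := mul_mem (zpow_mem (mul_mem (inv_mem m1) m2) k) (zpow_mem m1 (k - l))
    rw [← zpow_neg, ← zpow_add, ← zpow_mul, ← zpow_mul, ← zpow_add] at m3
    have e : (-(1 - k - k) + (1 - l - l)) * k + (1 - k - k) * (k - l) = -l + k := by ring
    rw [e, MulAction.mem_stabilizer_iff, Equiv.Perm.smul_def, zpow_add, Equiv.Perm.mul_apply] at m3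
    have := congrArg (r ^ l) m3
    rw [← Equiv.Perm.mul_apply, ← zpow_add] at this
    simpa using this

/-- Feasible points for the matching polytope relaxation, in matrix form. -/
structure FeasM [Fintype V] (z : V → V → ℝ) : Prop where
  nonneg : ∀ i j, 0 ≤ z i j
  symm : ∀ i j, z i j = z j i
  row : ∀ i, ∑ j, z i j ≤ 1
  odd : ∀ U : Finset V, Odd U.card → ∑ i ∈ U, ∑ j ∈ U, z i j ≤ (U.card : ℝ) - 1

/-- A valid inequality `a ≤ b`. -/
structure ValidIneq [Fintype V] (a : V → V → ℝ) (b : ℝ) : Prop where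
  diag : ∀ i, a i i = 0
  le : ∀ f, Function.Involutive f → invW a f ≤ b
  lt : ∃ f, Function.Involutive f ∧ invW a f < b
  feas : ∀ z, FeasM z → ∑ i, ∑ j, a i j * z i j ≤ b

lemma swap_involutive [DecidableEq V] (u v : V) :
    Function.Involutive (Equiv.swap u v : V → V) := fun i => by simp

lemma valid_edge [Fintype V] [DecidableEq V] {u v : V} (huv : u ≠ v) :
    ValidIneq (fun i j => if i = u ∧ j = v then (-1 : ℝ) else 0) 0 where
  diag i := by
    have : ¬ (i = u ∧ i = v) := by rintro ⟨rfl, h⟩; exact huv h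
    simp [this]
  le f _ := Finset.sum_nonpos fun i _ => by dsimp only; split_ifs <;> norm_num
  lt := ⟨Equiv.swap u v, swap_involutive u v, by
    unfold invW
    refine Finset.sum_neg' (fun i _ => by dsimp only; split_ifs <;> norm_num) ⟨u, by simp, by simp⟩⟩
  feas z hz := Finset.sum_nonpos fun i _ => Finset.sum_nonpos fun j _ => by
    have := hz.nonneg i j
    split_ifs <;> linarith

lemma invW_vertex [Fintype V] [DecidableEq V] (v : V) (f : V → V) :
    invW (fun i j => if i = v ∧ j ≠ v then (1 : ℝ) else 0) f = if f v ≠ v then 1 else 0 := by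
  unfold invW
  rw [Finset.sum_eq_single v]
  · simp
  · intro i _ hi; simp [hi]
  · simp

lemma valid_vertex [Fintype V] [DecidableEq V] (v : V) :
    ValidIneq (fun i j => if i = v ∧ j ≠ v then (1 : ℝ) else 0) 1 where
  diag i := by simp
  le f _ := by rw [invW_vertex]; split_ifs <;> norm_num
  lt := ⟨id, fun _ => rfl, by rw [invW_vertex]; simp⟩
  feas z hz := by
    rw [Finset.sum_eq_single v]
    · refine le_trans (Finset.sum_le_sum fun j _ => ?_) (hz.row v)
      have := hz.nonneg v j
      split_ifs <;> linarith
    · intro i _ hi; simp [hi]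
    · simp

lemma invW_odd [Fintype V] [DecidableEq V] (U : Finset V) (f : V → V) :
    invW (fun i j => if i ∈ U ∧ j ∈ U ∧ i ≠ j then (1 : ℝ) else 0) f
      = ((U.filter (fun i => f i ∈ U ∧ i ≠ f i)).card : ℝ) := by
  unfold invW
  rw [Finset.sum_boole]
  congr 2
  ext i; simp

lemma valid_odd [Fintype V] [DecidableEq V] {U : Finset V} (hU : Odd U.card)
    (h2 : 1 < U.card) :
    ValidIneq (fun i j => if i ∈ U ∧ j ∈ U ∧ i ≠ j then (1 : ℝ) else 0) ((U.card : ℝ) - 1) where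
  diag i := by simp
  le f hf := by
    rw [invW_odd]
    have hle : (U.filter (fun i => f i ∈ U ∧ i ≠ f i)).card ≤ U.card := Finset.card_filter_le _ _
    have hev : Even (U.filter (fun i => f i ∈ U ∧ i ≠ f i)).card := by
      refine even_card_of_inv hf (fun i hi => ?_) (fun i hi => ?_)
      · simp only [Finset.mem_filter] at hi ⊢
        exact ⟨hi.2.1, by simpa [hf i] using hi.1, by rw [hf i]; exact hi.2.2.symm⟩
      · simp only [Finset.mem_filter] at hi
        exact hi.2.2.symm
    have : (U.filter (fun i => f i ∈ U ∧ i ≠ f i)).card + 1 ≤ U.card := by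
      rcases hle.lt_or_eq with h | h
      · exact h
      · rw [h] at hev; exact absurd hU (Nat.not_odd_iff_even.2 hev)
    have : ((U.filter (fun i => f i ∈ U ∧ i ≠ f i)).card : ℝ) + 1 ≤ U.card := by exact_mod_cast this
    linarith
  lt := ⟨id, fun _ => rfl, by
    rw [invW_odd]
    have : (1 : ℝ) < U.card := by exact_mod_cast h2
    simpa using this⟩
  feas z hz := by
    refine le_trans ?_ (hz.odd U hU)
    rw [← Finset.sum_subset (Finset.subset_univ U)]
    · refine Finset.sum_le_sum fun i hi => ?_
      rw [← Finset.sum_subset (Finset.subset_univ U)]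
      · refine Finset.sum_le_sum fun j _ => ?_
        have := hz.nonneg i j
        split_ifs <;> linarith
      · intro j _ hj; simp [hj]
    · intro i _ hi; simp [hi]

lemma invW_symmetrize [Fintype V] (w : V → V → ℝ) {f : V → V} (hf : Function.Involutive f) :
    invW (fun i j => w i j + w j i) f = 2 * invW w f := by
  unfold invW
  rw [Finset.sum_add_distrib, two_mul]
  congr 1
  have := Equiv.sum_comp hf.toPerm (fun i => w i (f i))
  rw [← this]
  simp [hf _]

lemma tight_exists_symm [Fintype V] [DecidableEq V] (w : V → V → ℝ)
    (hs : ∀ i j, w i j = w j i) (hd : ∀ i, w i i = 0) (hne : ∃ u v, w u v ≠ 0) :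
    ∃ a b, ValidIneq a b ∧ ∀ f, MaxInv w f → invW a f = b := by
  classical
  by_cases hneg : ∃ u v, w u v < 0
  · obtain ⟨u, v, huv⟩ := hneg
    have hne : u ≠ v := by rintro rfl; rw [hd] at huv; exact lt_irrefl _ huv
    refine ⟨_, _, valid_edge hne, fun f hf => ?_⟩
    refine Finset.sum_eq_zero fun i _ => ?_
    dsimp only
    rw [if_neg]
    rintro ⟨rfl, h⟩
    have hv : f v = i := by rw [← h, hf.1]
    have hid : Function.Involutive (id : V → V) := fun _ => rfl
    have hinv := splice_involutive (S := {i, v}) hf.1 hid (by simp [h, hv]) (by simp)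
    have := hf.2 _ hinv
    have hlt : invW w f < invW w (splice f id {i, v}) := by
      refine Finset.sum_lt_sum (fun j _ => ?_) ⟨i, by simp, by simp [splice, h, hd, huv]⟩
      by_cases hj : j = i ∨ j = v
      · rcases hj with rfl | rfl
        · simp [splice, h, hd, huv.le]
        · simp [splice, hv, hd, hs j i, huv.le]
      · have : j ∉ ({i, v} : Finset V) := by simpa using hj
        simp only [splice, if_neg this, le_refl]
    linarith
  push Not at hneg
  obtain ⟨a, b, hab⟩ := hne
  have hab : 0 < w a b := lt_of_le_of_ne (hneg a b) hab.symm
  set K : Finset V := Finset.univ.filter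
    (fun v => Relation.ReflTransGen (fun i j => 0 < w i j) a v) with hK
  have hmem : ∀ v, v ∈ K ↔ Relation.ReflTransGen (fun i j => 0 < w i j) a v := by simp [hK]
  have haK : a ∈ K := (hmem a).2 .refl
  have hbK : b ∈ K := (hmem b).2 (.single hab)
  have hneab : a ≠ b := by rintro rfl; rw [hd] at hab; exact lt_irrefl _ hab
  by_cases hB : ∃ v ∈ K, ∀ f, MaxInv w f → f v ≠ v
  · obtain ⟨v, _, hv⟩ := hB
    exact ⟨_, _, valid_vertex v, fun f hf => by rw [invW_vertex, if_pos (hv f hf)]⟩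
  push Not at hB
  -- no maximizer misses two vertices of K
  have hadj : ∀ u v, 0 < w u v → ∀ f, MaxInv w f → f u = u → f v = v → u = v := by
    intro u v huv f hf hu hv
    exfalso
    have hne : u ≠ v := by rintro rfl; rw [hd] at huv; exact lt_irrefl _ huv
    have hinv := splice_involutive (S := {u, v}) hf.1 (swap_involutive u v) (by simp [hu, hv])
      (by simp)
    have := hf.2 _ hinv
    have hlt : invW w f < invW w (splice f (Equiv.swap u v) {u, v}) := by
      refine Finset.sum_lt_sum (fun j _ => ?_) ⟨u, by simp, by simp [splice, hu, hd, huv]⟩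
      by_cases hj : j = u ∨ j = v
      · rcases hj with rfl | rfl
        · simp [splice, hu, hd, huv.le]
        · simp [splice, hv, hd, hs j u, huv.le]
      · have : j ∉ ({u, v} : Finset V) := by simpa using hj
        simp only [splice, if_neg this, le_refl]
    linarith
  have htrans : ∀ u t v, t ∈ K → (∀ f, MaxInv w f → f u = u → f t = t → u = t) →
      (∀ f, MaxInv w f → f t = t → f v = v → t = v) →
      ∀ f, MaxInv w f → f u = u → f v = v → u = v := by
    intro u t v htK h1 h2 f hf hu hv
    by_contra huv
    obtain ⟨g, hg, hgt⟩ := hB t htK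
    obtain ⟨S, htS, hfS, hgS, huniq⟩ := orbit_exists hf.1 hg.1 hgt
    have hM := hf.splice hg hfS hgS
    have hMt : splice f g S t = t := by simp [splice, htS, hgt]
    have hut : u ≠ t := by
      rintro rfl; exact huv (h2 f hf hu hv)
    have hvt : t ≠ v := by
      rintro rfl; exact huv (h1 f hf hu hv)
    by_cases huS : u ∈ S
    · have hvS : v ∉ S := fun hvS => huv (huniq u huS v hvS hu hv)
      exact hvt (h2 _ hM hMt (by simp [splice, hvS, hv]))
    · exact hut (h1 _ hM (by simp [splice, huS, hu]) hMt)
  have hPa : ∀ v, Relation.ReflTransGen (fun i j => 0 < w i j) a v →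
      ∀ f, MaxInv w f → f a = a → f v = v → a = v := by
    intro v hv
    induction hv with
    | refl => intros; rfl
    | tail h1 h2 ih => exact htrans _ _ _ ((hmem _).2 h1) ih (hadj _ _ h2)
  have hP : ∀ u ∈ K, ∀ v ∈ K, ∀ f, MaxInv w f → f u = u → f v = v → u = v := by
    intro u hu v hv
    exact htrans u a v haK (fun f hf h1 h2 => (hPa u ((hmem u).1 hu) f hf h2 h1).symm)
      (hPa v ((hmem v).1 hv))
  -- drop zero edges
  have hdrop : ∀ f, MaxInv w f → ∃ f', MaxInv w f' ∧ (∀ i, f i = i → f' i = i) ∧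
      (∀ i ∈ K, f' i ≠ i → f' i ∈ K ∧ f i = f' i) := by
    intro f hf
    set S : Finset V := Finset.univ.filter (fun i => w i (f i) = 0) with hS
    have hfS : ∀ i ∈ S, f i ∈ S := by
      intro i hi
      simp only [hS, Finset.mem_filter, Finset.mem_univ, true_and] at hi ⊢
      rw [hf.1, hs]; exact hi
    have hid : Function.Involutive (id : V → V) := fun _ => rfl
    have hinv := splice_involutive (S := S) hf.1 hid hfS (by simp)
    have hW : invW w (splice f id S) = invW w f := by
      refine Finset.sum_congr rfl fun i _ => ?_
      by_cases hi : i ∈ S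
      · have : w i (f i) = 0 := by simpa [hS] using hi
        simp [splice, hi, hd, this]
      · simp [splice, hi]
    refine ⟨splice f id S, ⟨hinv, by rw [hW]; exact hf.2⟩, ?_, ?_⟩
    · intro i hi; unfold splice; split_ifs <;> simp [hi]
    · intro i hi hne
      by_cases hiS : i ∈ S
      · simp [splice, hiS] at hne
      · simp only [splice, if_neg hiS, and_true]
        have h0 : w i (f i) ≠ 0 := by simpa [hS] using hiS
        exact (hmem _).2 (((hmem i).1 hi).tail (lt_of_le_of_ne (hneg _ _) h0.symm))
  have hodd : Odd K.card := by
    obtain ⟨f, hf, hfa⟩ := hB a haK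
    obtain ⟨f', hf', h1, h2⟩ := hdrop f hf
    have hf'a := h1 a hfa
    have : Even (K.erase a).card := by
      have hne : ∀ i ∈ K.erase a, f' i ≠ i := fun i hi h =>
        (Finset.ne_of_mem_erase hi) (hP i (Finset.mem_of_mem_erase hi) a haK f' hf' h hf'a)
      refine even_card_of_inv hf'.1 (fun i hi => ?_) hne
      refine Finset.mem_erase.2 ⟨fun h => ?_, (h2 i (Finset.mem_of_mem_erase hi) (hne i hi)).1⟩
      apply Finset.ne_of_mem_erase hi
      rw [← hf'.1 i, h, hf'a]
    rw [← Finset.card_erase_add_one haK]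
    exact this.add_one
  have hcard : 1 < K.card := Finset.one_lt_card.2 ⟨a, haK, b, hbK, hneab⟩
  refine ⟨_, _, valid_odd hodd hcard, fun f hf => ?_⟩
  refine le_antisymm ((valid_odd hodd hcard).le f hf.1) ?_
  rw [invW_odd]
  obtain ⟨f', hf', h1, h2⟩ := hdrop f hf
  have hsub : K.filter (fun i => ¬ (f i ∈ K ∧ i ≠ f i)) ⊆ K.filter (fun i => f' i = i) := by
    intro i hi
    simp only [Finset.mem_filter] at hi ⊢
    refine ⟨hi.1, ?_⟩
    by_contra h
    obtain ⟨h3, h4⟩ := h2 i hi.1 h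
    exact hi.2 ⟨h4 ▸ h3, by rw [h4]; exact Ne.symm h⟩
  have hle1 : (K.filter (fun i => f' i = i)).card ≤ 1 := by
    rw [Finset.card_le_one]
    intro u hu v hv
    simp only [Finset.mem_filter] at hu hv
    exact hP u hu.1 v hv.1 f' hf' hu.2 hv.2
  have hsum := Finset.card_filter_add_card_filter_not (s := K) (fun i => f i ∈ K ∧ i ≠ f i)
  have hle := Finset.card_le_card hsub
  have : K.card ≤ (K.filter (fun i => f i ∈ K ∧ i ≠ f i)).card + 1 := by omega
  have : (K.card : ℝ) ≤ (K.filter (fun i => f i ∈ K ∧ i ≠ f i)).card + 1 := by exact_mod_cast this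
  linarith

lemma invW_sub_smul [Fintype V] (w a : V → V → ℝ) (ε : ℝ) (f : V → V) :
    invW (fun i j => w i j - ε * a i j) f = invW w f - ε * invW a f := by
  simp [invW, Finset.sum_sub_distrib, Finset.mul_sum]

lemma edmonds_dual [Fintype V] [DecidableEq V] {z : V → V → ℝ} (hz : FeasM z) :
    ∀ (n : ℕ) (w : V → V → ℝ) (f₀ : V → V), (∀ i, w i i = 0) → MaxInv w f₀ →
      Set.ncard {f : V → V | Function.Involutive f ∧ invW w f < invW w f₀} = n →
      ∑ i, ∑ j, w i j * z i j ≤ invW w f₀ := by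
  classical
  intro n
  induction n using Nat.strong_induction_on with
  | _ n ih =>
  intro w f₀ hd hf₀ hn
  set w' : V → V → ℝ := fun i j => w i j + w j i with hw'
  by_cases hne : ∃ u v, w' u v ≠ 0
  · obtain ⟨a, b, hv, ht⟩ := tight_exists_symm w' (fun i j => add_comm _ _)
      (fun i => by simp [hw', hd]) hne
    have ht : ∀ f, MaxInv w f → invW a f = b := by
      intro f hf
      refine ht f ⟨hf.1, fun g hg => ?_⟩
      rw [invW_symmetrize w hf.1, invW_symmetrize w hg]
      linarith [hf.2 g hg]
    -- choose epsilon
    set T : Finset (V → V) := Finset.univ.filter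
      (fun f => Function.Involutive f ∧ invW a f < b) with hT
    have hTne : T.Nonempty := by
      obtain ⟨f, h1, h2⟩ := hv.lt
      exact ⟨f, by simp [hT, h1, h2]⟩
    obtain ⟨k, hkT, hk⟩ := Finset.exists_min_image T
      (fun f => (invW w f₀ - invW w f) / (b - invW a f)) hTne
    set ε := (invW w f₀ - invW w k) / (b - invW a k) with hε
    have hkT' : Function.Involutive k ∧ invW a k < b := by simpa [hT] using hkT
    have hε0 : 0 ≤ ε := div_nonneg (by linarith [hf₀.2 k hkT'.1]) (by linarith [hkT'.2])
    have hf₀b := ht f₀ hf₀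
    have hkey : ∀ f, Function.Involutive f →
        invW w f - ε * invW a f ≤ invW w f₀ - ε * b := by
      intro f hf
      rcases (hv.le f hf).lt_or_eq with h | h
      · have h1 := hk f (by simp [hT, hf, h])
        have h2 : ε ≤ (invW w f₀ - invW w f) / (b - invW a f) := h1
        rw [le_div_iff₀ (by linarith)] at h2
        linarith
      · rw [h]; linarith [hf₀.2 f hf]
    have hkeq : invW w k - ε * invW a k = invW w f₀ - ε * b := by
      have : ε * (b - invW a k) = invW w f₀ - invW w k := by
        rw [hε]; exact div_mul_cancel₀ _ (by linarith [hkT'.2])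
      linarith
    have hmax : MaxInv (fun i j => w i j - ε * a i j) f₀ := by
      refine ⟨hf₀.1, fun g hg => ?_⟩
      rw [invW_sub_smul, invW_sub_smul, hf₀b]
      exact hkey g hg
    have hlt : Set.ncard {f : V → V | Function.Involutive f ∧
        invW (fun i j => w i j - ε * a i j) f < invW (fun i j => w i j - ε * a i j) f₀} < n := by
      rw [← hn]
      refine Set.ncard_lt_ncard ?_ (Set.toFinite _)
      rw [Set.ssubset_iff_of_subset]
      · refine ⟨k, ⟨hkT'.1, ?_⟩, ?_⟩
        · by_contra hcon
          have hkm : MaxInv w k := ⟨hkT'.1, fun g hg => by linarith [hf₀.2 g hg]⟩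
          have := ht k hkm
          linarith [hkT'.2]
        · rintro ⟨_, h⟩
          rw [invW_sub_smul, invW_sub_smul, hf₀b, hkeq] at h
          exact lt_irrefl _ h
      · rintro f ⟨h1, h2⟩
        refine ⟨h1, ?_⟩
        rw [invW_sub_smul, invW_sub_smul, hf₀b] at h2
        have := mul_le_mul_of_nonneg_left (hv.le f h1) hε0
        linarith
    have := ih _ hlt _ f₀ (fun i => by simp [hd, hv.diag]) hmax rfl
    rw [invW_sub_smul, hf₀b] at this
    have e : ∑ i, ∑ j, (w i j - ε * a i j) * z i j
        = ∑ i, ∑ j, w i j * z i j - ε * ∑ i, ∑ j, a i j * z i j := by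
      simp only [Finset.mul_sum, ← Finset.sum_sub_distrib]
      refine Finset.sum_congr rfl fun i _ => Finset.sum_congr rfl fun j _ => by ring
    rw [e] at this
    have := mul_le_mul_of_nonneg_left (hv.feas z hz) hε0
    linarith
  · push Not at hne
    have h0 : ∑ i, ∑ j, w i j * z i j = 0 := by
      have h1 : ∑ i, ∑ j, w i j * z i j = ∑ i, ∑ j, w j i * z i j := by
        rw [Finset.sum_comm]
        refine Finset.sum_congr rfl fun i _ => Finset.sum_congr rfl fun j _ => by rw [hz.symm]
      have h2 : ∑ i, ∑ j, w i j * z i j + ∑ i, ∑ j, w j i * z i j = 0 := by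
        simp only [← Finset.sum_add_distrib, ← add_mul]
        refine Finset.sum_eq_zero fun i _ => Finset.sum_eq_zero fun j _ => ?_
        have := hne i j
        simp only [hw'] at this
        rw [this, zero_mul]
      linarith
    rw [h0]
    have := hf₀.2 id (fun _ => rfl)
    have e : invW w id = 0 := by simp [invW, hd]
    linarith

/-- The matrix of a matching given by an involution. -/
def invMat [DecidableEq V] (f : V → V) : V × V → ℝ :=
  fun p => if f p.1 = p.2 ∧ p.1 ≠ p.2 then 1 else 0

lemma edmonds_matching [Fintype V] [DecidableEq V] {z : V → V → ℝ} (hz : FeasM z)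
    (hz0 : ∀ i, z i i = 0) :
    (fun p : V × V => z p.1 p.2) ∈ convexHull ℝ
      (Set.range (fun f : {f : V → V // Function.Involutive f} => invMat f.1)) := by
  classical
  by_contra hcon
  have hfin := Set.finite_range (fun f : {f : V → V // Function.Involutive f} => invMat f.1)
  obtain ⟨φ, u, h1, h2⟩ := geometric_hahn_banach_closed_point (convex_convexHull ℝ _)
    (hfin.isClosed_convexHull (𝕜 := ℝ)) hcon
  have hφ : ∀ x : V × V → ℝ, φ x = ∑ p, φ (Pi.single p 1) * x p := by
    intro x
    conv_lhs => rw [pi_eq_sum_univ' x]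
    rw [map_sum]
    refine Finset.sum_congr rfl fun p _ => ?_
    rw [map_smul, smul_eq_mul, mul_comm]
  set w : V → V → ℝ := fun i j => if i = j then 0 else φ (Pi.single (i, j) 1) with hw
  obtain ⟨f₀, hf₀, hmax⟩ := Finset.exists_max_image
    (Finset.univ.filter (fun f : V → V => Function.Involutive f)) (invW w)
    ⟨id, Finset.mem_filter.2 ⟨Finset.mem_univ _, fun _ => rfl⟩⟩
  have hM : MaxInv w f₀ := ⟨by simpa using hf₀, fun g hg => hmax g (by simpa using hg)⟩
  have hle := edmonds_dual hz _ w f₀ (by simp [hw]) hM rfl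
  have e1 : φ (fun p : V × V => z p.1 p.2) = ∑ i, ∑ j, w i j * z i j := by
    rw [hφ, Fintype.sum_prod_type]
    refine Finset.sum_congr rfl fun i _ => Finset.sum_congr rfl fun j _ => ?_
    by_cases h : i = j
    · subst h; simp [hz0]
    · simp [hw, h]
  have e2 : φ (invMat f₀) = invW w f₀ := by
    rw [hφ, Fintype.sum_prod_type]
    refine Finset.sum_congr rfl fun i _ => ?_
    rw [Finset.sum_eq_single (f₀ i)]
    · by_cases h : i = f₀ i
      · simp [invMat, hw, ← h]
      · simp [invMat, hw, h]
    · intro j _ hj; simp [invMat, hj.symm]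
    · simp
  have := h1 (invMat f₀) (subset_convexHull ℝ _ ⟨⟨f₀, hM.1⟩, rfl⟩)
  linarith

/-! ### Part B: polyhedral lemmas -/

section Polyhedral

variable {E : Type*} [AddCommGroup E] [Module ℝ E]

lemma small_step {I : Type*} (J : Finset I) (φ : I → E →ₗ[ℝ] ℝ) (b : I → ℝ) (q d : E)
    (h : ∀ j ∈ J, b j < φ j q) :
    ∃ ε : ℝ, 0 < ε ∧ ε ≤ 1 ∧ ∀ j ∈ J, b j ≤ φ j (q + ε • d) := by
  have h1 : ∀ᶠ ε in nhdsWithin (0 : ℝ) (Set.Ioi 0), ∀ j ∈ J, b j < φ j q + ε * φ j d := by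
    rw [Filter.eventually_all_finset]
    intro j hj
    have hc : Continuous (fun ε : ℝ => φ j q + ε * φ j d) := by fun_prop
    have ht : Filter.Tendsto (fun ε : ℝ => φ j q + ε * φ j d) (nhds 0) (nhds (φ j q)) := by
      have := hc.tendsto 0
      simpa using this
    exact (ht.mono_left nhdsWithin_le_nhds).eventually_const_lt (h j hj)
  have h2 : ∀ᶠ ε in nhdsWithin (0 : ℝ) (Set.Ioi 0), ε ∈ Set.Ioc (0 : ℝ) 1 :=
    Ioc_mem_nhdsGT one_pos
  obtain ⟨ε, h3, h4⟩ := (h1.and h2).exists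
  exact ⟨ε, h4.1, h4.2, fun j hj => by simpa using (h3 j hj).le⟩

/-- The point of a segment where a linear functional takes an intermediate value. -/
lemma segment_hit (ψ : E →ₗ[ℝ] ℝ) (β : ℝ) (p w : E) (hp : β < ψ p) (hw : ψ w < β) :
    ∃ t : ℝ, 0 < t ∧ t < 1 ∧ ψ (p + t • (w - p)) = β := by
  have hpos : 0 < ψ p - ψ w := by linarith
  refine ⟨(ψ p - β) / (ψ p - ψ w), div_pos (by linarith) hpos,
    (div_lt_one hpos).2 (by linarith), ?_⟩
  simp only [map_add, map_smul, map_sub, smul_eq_mul]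
  field_simp
  ring

lemma facet_abstract {I : Type*} [Fintype I] [DecidableEq I] (D : Submodule ℝ E)
    (φ : I → E →ₗ[ℝ] ℝ) (b : I → ℝ) (p z : E) (hp : ∀ i, b i < φ i p) (hzD : z - p ∈ D)
    (hz : ∃ i, φ i z < b i) :
    ∃ i, φ i z < b i ∧ ∃ q, q - p ∈ D ∧ φ i q = b i ∧
      ∀ d ∈ D, φ i d = 0 → ∃ ε : ℝ, 0 < ε ∧ ε ≤ 1 ∧
        (q + ε • d) - p ∈ D ∧ ∀ j, b j ≤ φ j (q + ε • d) := by
  classical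
  let good : Finset I → Prop := fun J =>
    ∀ y, y - p ∈ D → (∀ j ∈ J, b j ≤ φ j y) → ∀ j, b j ≤ φ j y
  have hgood : (Finset.univ.filter good).Nonempty :=
    ⟨Finset.univ, Finset.mem_filter.2 ⟨Finset.mem_univ _, fun y _ h j => h j (Finset.mem_univ j)⟩⟩
  obtain ⟨J, hJ, hmin⟩ := Finset.exists_min_image _ Finset.card hgood
  have hJ : good J := by simpa using hJ
  obtain ⟨i, hiJ, hi⟩ : ∃ i ∈ J, φ i z < b i := by
    by_contra hcon
    push Not at hcon
    obtain ⟨i, hi⟩ := hz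
    exact absurd (hJ z hzD hcon i) (not_le.2 hi)
  have hnot : ¬ good (J.erase i) := by
    intro h
    have := hmin (J.erase i) (by simpa using h)
    exact absurd this (not_le.2 (Finset.card_erase_lt_of_mem hiJ))
  simp only [good] at hnot
  push Not at hnot
  obtain ⟨w, hwD, hw, k, hk⟩ := hnot
  have hwi : φ i w < b i := by
    by_contra hcon
    push Not at hcon
    refine absurd (hJ w hwD (fun j hj => ?_) k) (not_le.2 hk)
    by_cases h : j = i
    · rw [h]; exact hcon
    · exact hw j (Finset.mem_erase.2 ⟨h, hj⟩)
  obtain ⟨t, ht0, ht1, ht⟩ := segment_hit (φ i) (b i) p w (hp i) hwi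
  set q := p + t • (w - p) with hq
  have hqD : q - p ∈ D := by
    rw [hq, add_sub_cancel_left]; exact D.smul_mem _ hwD
  refine ⟨i, hi, q, hqD, ht, fun d hd hid => ?_⟩
  obtain ⟨ε, h0, h1, h2⟩ := small_step (J.erase i) φ b q d (by
    intro j hj
    have e : φ j q = (1 - t) * φ j p + t * φ j w := by
      simp only [hq, map_add, map_smul, map_sub, smul_eq_mul]; ring
    have := mul_lt_mul_of_pos_left (hp j) (sub_pos.2 ht1)
    have := mul_le_mul_of_nonneg_left (hw j hj) ht0.le
    rw [e]; linarith)
  have hD : (q + ε • d) - p ∈ D := by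
    rw [add_sub_right_comm]; exact D.add_mem hqD (D.smul_mem _ hd)
  refine ⟨ε, h0, h1, hD, hJ _ hD fun j hj => ?_⟩
  by_cases h : j = i
  · rw [h]; simp [ht, hid]
  · exact h2 j (Finset.mem_erase.2 ⟨h, hj⟩)

lemma direction_eq (s : Set E) (D : Submodule ℝ E) (q : E) (hq : q ∈ s)
    (h1 : ∀ y ∈ s, y - q ∈ D) (h2 : ∀ d ∈ D, ∃ ε : ℝ, 0 < ε ∧ q + ε • d ∈ s) :
    (affineSpan ℝ s).direction = D := by
  rw [direction_affineSpan]
  apply le_antisymm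
  · rw [vectorSpan_def, Submodule.span_le]
    rintro _ ⟨a, ha, c, hc, rfl⟩
    have := D.sub_mem (h1 a ha) (h1 c hc)
    simpa using this
  · intro d hd
    obtain ⟨ε, h0, h⟩ := h2 d hd
    have := (vectorSpan ℝ s).smul_mem ε⁻¹ (vsub_mem_vectorSpan ℝ h hq)
    rwa [vsub_eq_sub, add_sub_cancel_left, smul_smul, inv_mul_cancel₀ h0.ne', one_smul] at this

lemma finrank_inf_ker [FiniteDimensional ℝ E] (D : Submodule ℝ E) (ψ : E →ₗ[ℝ] ℝ)
    (h : ∃ d ∈ D, ψ d ≠ 0) :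
    Module.finrank ℝ (D ⊓ LinearMap.ker ψ : Submodule ℝ E) = Module.finrank ℝ D - 1 := by
  have h1 := LinearMap.finrank_range_add_finrank_ker (ψ.domRestrict D)
  have h2 : LinearMap.range (ψ.domRestrict D) = ⊤ := by
    rw [LinearMap.range_eq_top]
    apply LinearMap.surjective
    intro h0
    obtain ⟨d, hd, hne⟩ := h
    exact hne (by simpa using LinearMap.congr_fun h0 ⟨d, hd⟩)
  have h3 : Submodule.map D.subtype (LinearMap.ker (ψ.domRestrict D)) = D ⊓ LinearMap.ker ψ := by
    ext y
    simp only [Submodule.mem_map, LinearMap.mem_ker, Submodule.mem_inf]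
    constructor
    · rintro ⟨⟨a, ha⟩, h, rfl⟩; exact ⟨ha, h⟩
    · rintro ⟨ha, h⟩; exact ⟨⟨y, ha⟩, h, rfl⟩
  rw [← h3, Submodule.finrank_map_subtype_eq]
  rw [h2, finrank_top, Module.finrank_self] at h1
  omega

lemma exists_interior {S : Set E} (hS : S.Finite) (hne : S.Nonempty) :
    ∃ p ∈ convexHull ℝ S, ∀ (ψ : E →ₗ[ℝ] ℝ) (b : ℝ), (∀ s ∈ S, b ≤ ψ s) →
      (∃ s ∈ S, b < ψ s) → b < ψ p := by
  classical
  set T := hS.toFinset with hT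
  have hTm : ∀ s, s ∈ T ↔ s ∈ S := by simp [hT]
  have hTne : T.Nonempty := by obtain ⟨s, hs⟩ := hne; exact ⟨s, (hTm s).2 hs⟩
  have hc : (0 : ℝ) < T.card := by exact_mod_cast hTne.card_pos
  refine ⟨∑ s ∈ T, (T.card : ℝ)⁻¹ • s, ?_, ?_⟩
  · refine (convex_convexHull ℝ S).sum_mem (fun _ _ => by positivity) ?_
      (fun s hs => subset_convexHull ℝ S ((hTm s).1 hs))
    rw [Finset.sum_const, nsmul_eq_mul, mul_inv_cancel₀ hc.ne']
  · rintro ψ b h1 ⟨s, hs, h2⟩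
    have e : b = ∑ _s ∈ T, (T.card : ℝ)⁻¹ * b := by
      rw [Finset.sum_const, nsmul_eq_mul, ← mul_assoc, mul_inv_cancel₀ hc.ne', one_mul]
    rw [map_sum, e]
    simp only [map_smul, smul_eq_mul]
    refine Finset.sum_lt_sum (fun a ha => ?_) ⟨s, (hTm s).2 hs, ?_⟩
    · exact mul_le_mul_of_nonneg_left (h1 a ((hTm a).1 ha)) (inv_pos.2 hc).le
    · exact mul_lt_mul_of_pos_left h2 (inv_pos.2 hc)

end Polyhedral

/-! ### Part C: translating between graphs and involutions -/

lemma row_sum [Fintype V] [DecidableEq V] (y : Sym2 V → ℝ) (v : V) :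
    ∑ e ∈ Finset.univ.filter (fun e : Sym2 V => v ∈ e), y e = ∑ j, y s(v, j) := by
  have himg : Finset.univ.filter (fun e : Sym2 V => v ∈ e)
      = Finset.univ.image (fun j => s(v, j)) := by
    ext e
    simp only [Finset.mem_filter, Finset.mem_univ, true_and, Finset.mem_image]
    constructor
    · rintro ⟨j, rfl⟩; exact ⟨j, rfl⟩
    · rintro ⟨j, rfl⟩; exact Sym2.mem_mk_left v j
  rw [himg, Finset.sum_image]
  intro i _ j _ h
  exact Sym2.congr_right.1 h

/-- The cut functional as a linear map. -/
noncomputable def cutL [Fintype V] (G : SimpleGraph V) (U : Set V) : (Sym2 V → ℝ) →ₗ[ℝ] ℝ :=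
  ∑ e ∈ (Set.toFinite (cutSet G U)).toFinset, LinearMap.proj e

lemma cutL_apply [Fintype V] (G : SimpleGraph V) (U : Set V) (y : Sym2 V → ℝ) :
    cutL G U y = ∑ᶠ e ∈ cutSet G U, y e := by
  rw [finsum_mem_eq_finite_toFinset_sum _ (Set.toFinite (cutSet G U))]
  simp [cutL]

lemma cutL_matrix [Fintype V] [DecidableEq V] (G : SimpleGraph V) (U : Finset V)
    (y : Sym2 V → ℝ) (hy : ∀ e, e ∉ G.edgeSet → y e = 0) :
    cutL G (U : Set V) y = ∑ i ∈ U, ∑ j ∈ Uᶜ, y s(i, j) := by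
  have e1 : ∑ i ∈ U, ∑ j ∈ Uᶜ, y s(i, j)
      = ∑ e ∈ (U ×ˢ Uᶜ).image (fun p : V × V => s(p.1, p.2)), y e := by
    rw [Finset.sum_image, Finset.sum_product]
    rintro ⟨a, b⟩ hab ⟨c, d⟩ hcd h
    simp only [Finset.coe_product, Finset.coe_compl, Set.mem_prod, Finset.mem_coe,
      Set.mem_compl_iff] at hab hcd
    rcases Sym2.eq_iff.1 h with ⟨h1, h2⟩ | ⟨h1, h2⟩
    · exact Prod.ext h1 h2
    · have h1 : a = d := h1
      exact absurd (h1 ▸ hab.1) hcd.2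
  rw [e1]
  simp only [cutL, LinearMap.coe_sum, Finset.sum_apply, LinearMap.proj_apply]
  apply Finset.sum_subset
  · intro e he
    rw [Set.Finite.mem_toFinset] at he
    obtain ⟨_, a, b, rfl, ha, hb⟩ := he
    refine Finset.mem_image.2 ⟨(a, b), ?_, rfl⟩
    simpa using ⟨ha, hb⟩
  · intro e he hne
    apply hy
    intro hG
    apply hne
    rw [Set.Finite.mem_toFinset]
    obtain ⟨⟨a, b⟩, hab, rfl⟩ := Finset.mem_image.1 he
    simp only [Finset.mem_product, Finset.mem_compl] at hab
    exact ⟨hG, a, b, rfl, by simpa using hab.1, by simpa using hab.2⟩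

lemma cutL_incVec [Fintype V] (G : SimpleGraph V) (U : Set V) (M : G.Subgraph) :
    cutL G U (incVecR G M) = ((M.edgeSet ∩ cutSet G U).ncard : ℝ) := by
  classical
  simp only [cutL, LinearMap.coe_sum, Finset.sum_apply, LinearMap.proj_apply, incVecR]
  rw [Finset.sum_boole, Set.ncard_eq_toFinset_card _ (Set.toFinite _)]
  congr 2
  ext e
  simp [and_comm]

lemma partner [Fintype V] (G : SimpleGraph V) (M : G.Subgraph) (hM : M.IsPerfectMatching) :
    ∃ f : V → V, Function.Involutive f ∧ (∀ v, f v ≠ v) ∧ ∀ u v, M.Adj u v ↔ f u = v := by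
  have h : ∀ v, ∃! w, M.Adj v w := fun v => hM.1 (hM.2 v)
  choose f hf hu using h
  have hiff : ∀ u v, M.Adj u v ↔ f u = v :=
    fun u v => ⟨fun h => (hu u v h).symm, fun h => h ▸ hf u⟩
  refine ⟨f, fun v => ?_, fun v h => ?_, hiff⟩
  · exact (hiff _ _).1 (hf v).symm
  · have := hf v
    rw [h] at this
    exact (M.adj_sub this).ne rfl

lemma incVecR_partner [DecidableEq V] (G : SimpleGraph V) (M : G.Subgraph) (f : V → V)
    (hf : ∀ u v, M.Adj u v ↔ f u = v) (u v : V) :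
    incVecR G M s(u, v) = if f u = v then 1 else 0 := by
  simp [incVecR, hf]

lemma incVecR_off (G : SimpleGraph V) (M : G.Subgraph) (e : Sym2 V) (he : e ∉ G.edgeSet) :
    incVecR G M e = 0 := by
  unfold incVecR
  exact if_neg fun h => he (M.edgeSet_subset h)

lemma incVecR_mem_bip [Fintype V] [DecidableEq V] (G : SimpleGraph V) (M : G.Subgraph)
    (hM : M.IsPerfectMatching) : incVecR G M ∈ bipRelaxation G := by
  obtain ⟨f, hf, hne, hadj⟩ := partner G M hM
  refine ⟨fun e => ?_, incVecR_off G M, fun v => ?_⟩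
  · unfold incVecR; split_ifs <;> norm_num
  · rw [row_sum]
    simp [incVecR_partner G M f hadj]

lemma one_le_cut_incVec [Fintype V] [DecidableEq V] (G : SimpleGraph V) (M : G.Subgraph)
    (hM : M.IsPerfectMatching) (U : Finset V) (hU : Odd U.card) :
    1 ≤ cutL G (U : Set V) (incVecR G M) := by
  obtain ⟨f, hf, hne, hadj⟩ := partner G M hM
  have hex : ∃ i ∈ U, f i ∉ U := by
    by_contra hcon
    push Not at hcon
    exact absurd hU (Nat.not_odd_iff_even.2 (even_card_of_inv hf hcon fun i _ => hne i))
  obtain ⟨i, hi, hfi⟩ := hex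
  rw [cutL_incVec]
  have : (M.edgeSet ∩ cutSet G (U : Set V)).ncard ≠ 0 := by
    rw [Ne, Set.ncard_eq_zero (Set.toFinite _), ← Ne, ← Set.nonempty_iff_ne_empty]
    have hA : M.Adj i (f i) := (hadj _ _).2 rfl
    exact ⟨s(i, f i), hA, M.adj_sub hA, i, f i, rfl, by simpa using hi, by simpa using hfi⟩
  exact_mod_cast Nat.one_le_iff_ne_zero.2 this

lemma convex_bip [Fintype V] [DecidableEq V] (G : SimpleGraph V) :
    Convex ℝ (bipRelaxation G) := by
  rintro x ⟨h1, h2, h3⟩ y ⟨k1, k2, k3⟩ a b ha hb hab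
  refine ⟨fun e => ?_, fun e he => ?_, fun v => ?_⟩
  · have := h1 e; have := k1 e
    simp only [Pi.add_apply, Pi.smul_apply, smul_eq_mul]; positivity
  · simp [h2 e he, k2 e he]
  · simp only [Pi.add_apply, Pi.smul_apply, smul_eq_mul, Finset.sum_add_distrib,
      ← Finset.mul_sum, h3, k3]
    linarith

lemma pm_subset_bip [Fintype V] [DecidableEq V] (G : SimpleGraph V) :
    pmPolytope G ⊆ bipRelaxation G := by
  refine convexHull_min ?_ (convex_bip G)
  rintro _ ⟨M, hM, rfl⟩
  exact incVecR_mem_bip G M hM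

lemma pm_cut [Fintype V] [DecidableEq V] (G : SimpleGraph V) (U : Finset V)
    (hU : Odd U.card) {y : Sym2 V → ℝ} (hy : y ∈ pmPolytope G) : 1 ≤ cutL G (U : Set V) y := by
  have hsub : pmPolytope G ⊆ {y | 1 ≤ cutL G (U : Set V) y} := by
    refine convexHull_min ?_ (convex_halfSpace_ge (cutL G (U : Set V)).isLinear 1)
    rintro _ ⟨M, hM, rfl⟩
    exact one_le_cut_incVec G M hM U hU
  exact hsub hy

/-- The spanning subgraph of an involution. -/
def invSub (G : SimpleGraph V) (f : V → V) (hf : Function.Involutive f)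
    (h : ∀ v, G.Adj v (f v)) : G.Subgraph where
  verts := Set.univ
  Adj u v := f u = v
  adj_sub := by rintro u _ rfl; exact h u
  edge_vert := fun _ => Set.mem_univ _
  symm := ⟨by rintro u _ rfl; exact hf u⟩

lemma invSub_perfect (G : SimpleGraph V) (f : V → V) (hf : Function.Involutive f)
    (h : ∀ v, G.Adj v (f v)) : (invSub G f hf h).IsPerfectMatching := by
  refine ⟨fun v _ => ⟨f v, rfl, fun y hy => Eq.symm hy⟩, fun v => Set.mem_univ v⟩

/-- The perfect matching polytope theorem of Edmonds. -/
lemma edmonds [Fintype V] [DecidableEq V] (G : SimpleGraph V) (x : Sym2 V → ℝ)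
    (hx : x ∈ bipRelaxation G)
    (hcut : ∀ U : Finset V, Odd U.card → 1 ≤ ∑ i ∈ U, ∑ j ∈ Uᶜ, x s(i, j)) :
    x ∈ pmPolytope G := by
  classical
  obtain ⟨hx0, hxG, hxv⟩ := hx
  have hrow : ∀ v, ∑ j, x s(v, j) = 1 := fun v => by rw [← row_sum, hxv]
  have hF : FeasM (fun i j => x s(i, j)) := by
    refine ⟨fun i j => hx0 _, fun i j => by rw [Sym2.eq_swap], fun i => (hrow i).le, ?_⟩
    intro U hU
    have h1 : ∑ i ∈ U, ∑ j ∈ U, x s(i, j) + ∑ i ∈ U, ∑ j ∈ Uᶜ, x s(i, j) = U.card := by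
      rw [← Finset.sum_add_distrib]
      simp [Finset.sum_add_sum_compl, hrow]
    have := hcut U hU
    linarith
  have hmem := edmonds_matching hF (fun i => hxG _ (by simp))
  obtain ⟨ι, _, w, a, hw0, hw1, ha, hsum⟩ := mem_convexHull_iff_exists_fintype.1 hmem
  choose f hf using ha
  have hval : ∀ u v, x s(u, v) = ∑ i, w i * (if (f i).1 u = v ∧ u ≠ v then 1 else 0) := by
    intro u v
    have := congrFun hsum (u, v)
    simp only [Finset.sum_apply, Pi.smul_apply, smul_eq_mul] at this
    rw [← this]
    refine Finset.sum_congr rfl fun i _ => ?_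
    rw [← hf i]; rfl
  have hfix : ∀ i, w i ≠ 0 → ∀ v, (f i).1 v ≠ v := by
    intro i hi v hv
    have h1 := hrow v
    simp only [hval] at h1
    rw [Finset.sum_comm] at h1
    have h2 : ∀ k, ∑ j, w k * (if (f k).1 v = j ∧ v ≠ j then (1 : ℝ) else 0)
        = w k * (if (f k).1 v = v then 0 else 1) := by
      intro k
      rw [← Finset.mul_sum]
      congr 1
      rw [Finset.sum_eq_single ((f k).1 v)]
      · by_cases h : (f k).1 v = v
        · simp [h]
        · simp [h, Ne.symm h]
      · intro j _ hj; simp [hj.symm]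
      · simp
    simp only [h2] at h1
    have hlt : ∑ k, w k * (if (f k).1 v = v then (0 : ℝ) else 1) < ∑ k, w k := by
      refine Finset.sum_lt_sum (fun k _ => ?_) ⟨i, Finset.mem_univ _, ?_⟩
      · have := hw0 k
        split_ifs <;> simp [this]
      · simp [hv, lt_of_le_of_ne (hw0 i) hi.symm]
    linarith
  have hG : ∀ i, w i ≠ 0 → ∀ v, G.Adj v ((f i).1 v) := by
    intro i hi v
    by_contra hcon
    have h0 := hxG s(v, (f i).1 v) (by simpa using hcon)
    rw [hval, Finset.sum_eq_zero_iff_of_nonneg] at h0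
    · have := h0 i (Finset.mem_univ _)
      simp [hi, (hfix i hi v).symm] at this
    · intro k _
      have := hw0 k
      split_ifs <;> simp [this]
  have hy : ∀ i, ∃ y : Sym2 V → ℝ, w i ≠ 0 →
      (∃ M : G.Subgraph, M.IsPerfectMatching ∧ y = incVecR G M) ∧
      ∀ u v, y s(u, v) = if (f i).1 u = v ∧ u ≠ v then 1 else 0 := by
    intro i
    by_cases hi : w i = 0
    · exact ⟨0, fun h => absurd hi h⟩
    · refine ⟨incVecR G (invSub G (f i).1 (f i).2 (hG i hi)), fun _ =>
        ⟨⟨_, invSub_perfect G _ _ _, rfl⟩, fun u v => ?_⟩⟩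
      rw [incVecR_partner G _ (f i).1 (fun _ _ => Iff.rfl)]
      have := hfix i hi u
      by_cases h : (f i).1 u = v
      · have h' : u ≠ v := fun h'' => this (h.trans h''.symm)
        simp [h, h']
      · simp [h]
  choose y hy using hy
  have hxe : x = ∑ i ∈ Finset.univ.filter (fun i => w i ≠ 0), w i • y i := by
    ext e
    induction e using Sym2.ind with
    | _ u v =>
    rw [hval, Finset.sum_apply, Finset.sum_filter]
    refine Finset.sum_congr rfl fun i _ => ?_
    by_cases hi : w i = 0
    · simp [hi]
    · rw [if_pos hi, Pi.smul_apply, (hy i hi).2, smul_eq_mul]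
  rw [hxe]
  refine (convex_convexHull ℝ _).sum_mem (fun i _ => hw0 i) ?_ (fun i hi => ?_)
  · rw [Finset.sum_filter_ne_zero, hw1]
  · exact subset_convexHull ℝ _ (hy i (Finset.mem_filter.1 hi).2).1

lemma face_support [Fintype V] [DecidableEq V] (G : SimpleGraph V) (U : Finset V)
    (hU : Odd U.card) {y : Sym2 V → ℝ} (hy : y ∈ pmPolytope G)
    (h1 : cutL G (U : Set V) y = 1) (e : Sym2 V) (he : 0 < y e) :
    ∃ M : G.Subgraph, M.IsPerfectMatching ∧ e ∈ M.edgeSet ∧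
      (M.edgeSet ∩ cutSet G (U : Set V)).ncard = 1 := by
  classical
  obtain ⟨ι, _, w, a, hw0, hw1, ha, hsum⟩ := mem_convexHull_iff_exists_fintype.1 hy
  choose M hM haM using ha
  have hex : ∃ i, w i * a i e ≠ 0 := by
    by_contra hcon
    push Not at hcon
    rw [← hsum] at he
    simp [hcon] at he
  obtain ⟨i, hi⟩ := hex
  have hwi := left_ne_zero_of_mul hi
  have hai := right_ne_zero_of_mul hi
  refine ⟨M i, hM i, ?_, ?_⟩
  · by_contra hcon
    apply hai
    rw [haM i]; simp [incVecR, hcon]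
  · have hc : ∀ k, 1 ≤ cutL G (U : Set V) (a k) := fun k => by
      rw [haM k]; exact one_le_cut_incVec G _ (hM k) U hU
    have h2 : ∑ k, w k * (cutL G (U : Set V) (a k) - 1) = 0 := by
      rw [← hsum, map_sum] at h1
      simp only [map_smul, smul_eq_mul] at h1
      simp only [mul_sub, Finset.sum_sub_distrib, mul_one]
      linarith
    rw [Finset.sum_eq_zero_iff_of_nonneg
      (fun k _ => mul_nonneg (hw0 k) (by linarith [hc k]))] at h2
    have h3 := h2 i (Finset.mem_univ _)
    have h4 : cutL G (U : Set V) (a i) = 1 := by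
      rcases mul_eq_zero.1 h3 with h | h
      · exact absurd h hwi
      · linarith
    rw [haM i, cutL_incVec] at h4
    exact_mod_cast h4

/-! ### Part D: assembly -/

/-- The direction space of the degree equations. -/
def degDir [Fintype V] [DecidableEq V] (G : SimpleGraph V) : Submodule ℝ (Sym2 V → ℝ) where
  carrier := {y | (∀ e, e ∉ G.edgeSet → y e = 0) ∧
    ∀ v : V, ∑ e ∈ Finset.univ.filter (fun e : Sym2 V => v ∈ e), y e = 0}
  add_mem' := by
    rintro a b ⟨h1, h2⟩ ⟨k1, k2⟩
    refine ⟨fun e he => by simp [h1 e he, k1 e he], fun v => ?_⟩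
    simp only [Pi.add_apply, Finset.sum_add_distrib, h2, k2, add_zero]
  zero_mem' := by simp
  smul_mem' := by
    rintro c a ⟨h1, h2⟩
    refine ⟨fun e he => by simp [h1 e he], fun v => ?_⟩
    simp only [Pi.smul_apply, smul_eq_mul, ← Finset.mul_sum, h2, mul_zero]

lemma sub_mem_degDir [Fintype V] [DecidableEq V] (G : SimpleGraph V) {x y : Sym2 V → ℝ}
    (hx : x ∈ bipRelaxation G) (hy : y ∈ bipRelaxation G) : y - x ∈ degDir G := by
  refine ⟨fun e he => by simp [hx.2.1 e he, hy.2.1 e he], fun v => ?_⟩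
  simp only [Pi.sub_apply, Finset.sum_sub_distrib, hx.2.2, hy.2.2, sub_self]

lemma mem_bip_of_degDir [Fintype V] [DecidableEq V] (G : SimpleGraph V) {x y : Sym2 V → ℝ}
    (hx : x ∈ bipRelaxation G) (hy : y - x ∈ degDir G) (h0 : ∀ e ∈ G.edgeSet, 0 ≤ y e) :
    y ∈ bipRelaxation G := by
  have hoff : ∀ e, e ∉ G.edgeSet → y e = 0 := by
    intro e he
    have := hy.1 e he
    simp only [Pi.sub_apply, hx.2.1 e he, sub_zero] at this
    exact this
  refine ⟨fun e => ?_, hoff, fun v => ?_⟩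
  · by_cases he : e ∈ G.edgeSet
    · exact h0 e he
    · exact (hoff e he).ge
  · have := hy.2 v
    simp only [Pi.sub_apply, Finset.sum_sub_distrib, hx.2.2] at this
    linarith

/-- from a fractional extreme point of the bipartite relaxation of a
non-BvN brick one obtains a separating odd cut violated by the point and inducing
a facet of the perfect matching polytope. -/
theorem fractional_vertex_gives_facet_cut [Fintype V] [DecidableEq V]
    (G : SimpleGraph V) (hBrick : IsBrick G) (hnb : ¬ IsBvN G)
    (x : Sym2 V → ℝ) (hx : x ∈ Set.extremePoints ℝ (bipRelaxation G))
    (hfrac : ¬ ∃ M : G.Subgraph, M.IsPerfectMatching ∧ x = incVecR G M) :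
    ∃ U : Set V, IsOddCutShore U ∧
      (∑ᶠ e ∈ cutSet G U, x e) < 1 ∧
      (∀ e ∈ G.edgeSet, ∃ M : G.Subgraph, M.IsPerfectMatching ∧
        e ∈ M.edgeSet ∧ (M.edgeSet ∩ cutSet G U).ncard = 1) ∧
      {y ∈ pmPolytope G | ∑ᶠ e ∈ cutSet G U, y e = 1}.Nonempty ∧
      affDim {y ∈ pmPolytope G | ∑ᶠ e ∈ cutSet G U, y e = 1}
        = affDim (pmPolytope G) - 1 := by
  classical
  obtain ⟨⟨_, hE, hcov⟩, _, htight⟩ := hBrick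
  set S : Set (Sym2 V → ℝ) := {x | ∃ M : G.Subgraph, M.IsPerfectMatching ∧ x = incVecR G M}
    with hS
  have hxb : x ∈ bipRelaxation G := hx.1
  have hxnot : x ∉ pmPolytope G := by
    intro h
    have h1 : x ∈ Set.extremePoints ℝ (pmPolytope G) :=
      inter_extremePoints_subset_extremePoints_of_subset (pm_subset_bip G) ⟨h, hx⟩
    have h2 : x ∈ S := extremePoints_convexHull_subset h1
    exact hfrac h2
  have hSfin : S.Finite := by
    have : S ⊆ Set.range (fun M : G.Subgraph => incVecR G M) := by
      rintro _ ⟨M, _, rfl⟩; exact ⟨M, rfl⟩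
    exact (Set.finite_range _).subset this
  have hSne : S.Nonempty := by
    obtain ⟨e, he⟩ := hE
    obtain ⟨M, hM, _⟩ := hcov e he
    exact ⟨_, M, hM, rfl⟩
  have heven : Even (Fintype.card V) := by
    obtain ⟨_, M, hM, rfl⟩ := hSne
    obtain ⟨f, hf, hne, _⟩ := partner G M hM
    exact even_card_of_inv (T := Finset.univ) hf (by simp) (fun i _ => hne i)
  obtain ⟨p, hpP, hpint⟩ := exists_interior hSfin hSne
  have hpP : p ∈ pmPolytope G := hpP
  have hpb := pm_subset_bip G hpP
  -- the constraint system
  let NT := {U : Finset V // Odd U.card ∧ 2 ≤ U.card ∧ 2 ≤ Uᶜ.card}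
  have hshore : ∀ U : Finset V, Odd U.card → IsOddCutShore (U : Set V) := by
    intro U hU
    refine ⟨by rwa [Set.ncard_coe_finset], ?_⟩
    rw [← Finset.coe_compl, Set.ncard_coe_finset]
    have := Finset.card_add_card_compl U
    rcases Nat.even_or_odd (Uᶜ.card) with h | h
    · exfalso
      have h2 := hU.add_even h
      rw [this] at h2
      exact Nat.not_even_iff_odd.2 h2 heven
    · exact h
  let φ : ({e // e ∈ G.edgeSet} ⊕ NT) → (Sym2 V → ℝ) →ₗ[ℝ] ℝ :=
    Sum.elim (fun e => LinearMap.proj e.1) (fun U => cutL G (U.1 : Set V))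
  let b : ({e // e ∈ G.edgeSet} ⊕ NT) → ℝ := Sum.elim (fun _ => 0) (fun _ => 1)
  have hpstrict : ∀ i, b i < φ i p := by
    rintro (⟨e, he⟩ | ⟨U, hU, hU2, hU3⟩)
    · refine hpint _ 0 ?_ ?_
      · rintro _ ⟨M, hM, rfl⟩
        exact (incVecR_mem_bip G M hM).1 e
      · obtain ⟨M, hM, heM⟩ := hcov e he
        refine ⟨_, ⟨M, hM, rfl⟩, ?_⟩
        simp [φ, incVecR, heM]
    · refine hpint _ 1 ?_ ?_
      · rintro _ ⟨M, hM, rfl⟩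
        exact one_le_cut_incVec G M hM U hU
      · have hnt : ¬ IsTightCut G (U : Set V) := fun h => htight _ h
          ⟨by rwa [Set.ncard_coe_finset],
            by rwa [← Finset.coe_compl, Set.ncard_coe_finset]⟩
        have : ∃ M : G.Subgraph, M.IsPerfectMatching ∧
            (M.edgeSet ∩ cutSet G (U : Set V)).ncard ≠ 1 := by
          by_contra hcon
          push Not at hcon
          exact hnt ⟨hshore U hU, hcon⟩
        obtain ⟨M, hM, hne⟩ := this
        refine ⟨_, ⟨M, hM, rfl⟩, ?_⟩
        have h1 := one_le_cut_incVec G M hM U hU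
        refine lt_of_le_of_ne h1 fun h2 => hne ?_
        change (1 : ℝ) = cutL G (U : Set V) _ at h2
        rw [cutL_incVec] at h2
        exact_mod_cast h2.symm
  have hPQ : ∀ y, y ∈ pmPolytope G ↔ y - p ∈ degDir G ∧ ∀ i, b i ≤ φ i y := by
    intro y
    constructor
    · intro hy
      have hyb := pm_subset_bip G hy
      refine ⟨sub_mem_degDir G hpb hyb, ?_⟩
      rintro (⟨e, he⟩ | ⟨U, hU, _⟩)
      · exact hyb.1 e
      · exact pm_cut G U hU hy
    · rintro ⟨hyD, hy⟩
      have hyb := mem_bip_of_degDir G hpb hyD (fun e he => hy (Sum.inl ⟨e, he⟩))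
      have hrow : ∀ v, ∑ j, y s(v, j) = 1 := fun v => by rw [← row_sum, hyb.2.2]
      have hdiag : ∀ v, y s(v, v) = 0 := fun v => hyb.2.1 _ (by simp)
      refine edmonds G y hyb fun U hU => ?_
      have hUc : Odd Uᶜ.card := by
        have := (hshore U hU).2
        rwa [← Finset.coe_compl, Set.ncard_coe_finset] at this
      have hsing : ∀ v, ∑ j ∈ ({v} : Finset V)ᶜ, y s(v, j) = 1 := by
        intro v
        have := Finset.sum_add_sum_compl ({v} : Finset V) (fun j => y s(v, j))
        rw [hrow, Finset.sum_singleton, hdiag, zero_add] at this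
        exact this
      by_cases h1 : U.card = 1
      · obtain ⟨v, rfl⟩ := Finset.card_eq_one.1 h1
        rw [Finset.sum_singleton, hsing]
      by_cases h2 : Uᶜ.card = 1
      · obtain ⟨v, hv⟩ := Finset.card_eq_one.1 h2
        have hU' : U = ({v} : Finset V)ᶜ := by rw [← hv, compl_compl]
        rw [Finset.sum_comm, hv, Finset.sum_singleton, hU']
        simp_rw [Sym2.eq_swap (b := v)]
        rw [hsing]
      · have hpos1 := hU.pos
        have hpos2 := hUc.pos
        have := hy (Sum.inr ⟨U, hU, by omega, by omega⟩)
        rw [← cutL_matrix G U y hyb.2.1]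
        exact this
  obtain ⟨i, hxi, q, hqD, hqi, hqd⟩ := facet_abstract (degDir G) φ b p x hpstrict
    (sub_mem_degDir G hpb hxb) (by
      by_contra hcon
      push Not at hcon
      exact hxnot ((hPQ x).2 ⟨sub_mem_degDir G hpb hxb, hcon⟩))
  rcases i with ⟨e, he⟩ | ⟨U, hU, hU2, hU3⟩
  · exact absurd (hxb.1 e) (not_le.2 hxi)
  have hxi : cutL G (U : Set V) x < 1 := hxi
  have hqi : cutL G (U : Set V) q = 1 := hqi
  have hpU : 1 < cutL G (U : Set V) p := hpstrict (Sum.inr ⟨U, hU, hU2, hU3⟩)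
  have hqd : ∀ d ∈ degDir G, cutL G (U : Set V) d = 0 → ∃ ε : ℝ, 0 < ε ∧ ε ≤ 1 ∧
      q + ε • d ∈ pmPolytope G := by
    intro d hd h0
    obtain ⟨ε, h1, h2, h3⟩ := hqd d hd h0
    exact ⟨ε, h1, h2, (hPQ _).2 h3⟩
  have hqP : q ∈ pmPolytope G := by
    obtain ⟨ε, _, _, h⟩ := hqd 0 (zero_mem _) (by simp)
    simpa using h
  simp only [← cutL_apply]
  refine ⟨(U : Set V), hshore U hU, hxi, ?_, ⟨q, hqP, hqi⟩, ?_⟩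
  · intro e he
    obtain ⟨t, ht0, ht1, ht⟩ := segment_hit (cutL G (U : Set V)) 1 p x hpU hxi
    set r := p + t • (x - p) with hr
    have hrD : r - q ∈ degDir G := by
      have h1 : r - p ∈ degDir G := by
        rw [hr, add_sub_cancel_left]
        exact (degDir G).smul_mem _ (sub_mem_degDir G hpb hxb)
      have := (degDir G).sub_mem h1 hqD
      simpa using this
    obtain ⟨ε, h0, h1, h2⟩ := hqd (r - q) hrD (by rw [map_sub, ht, hqi, sub_self])
    refine face_support G U hU h2 ?_ e ?_
    · rw [map_add, map_smul, map_sub, ht, hqi]; simp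
    · have hpe : 0 < p e := hpstrict (Sum.inl ⟨e, he⟩)
      have hxe := hxb.1 e
      have hqe := (pm_subset_bip G hqP).1 e
      have hre : r e = (1 - t) * p e + t * x e := by
        simp only [hr, Pi.add_apply, Pi.smul_apply, Pi.sub_apply, smul_eq_mul]; ring
      have hrpos : 0 < r e := by
        rw [hre]
        have := mul_pos (sub_pos.2 ht1) hpe
        have := mul_nonneg ht0.le hxe
        linarith
      have e1 : (q + ε • (r - q)) e = (1 - ε) * q e + ε * r e := by
        simp only [Pi.add_apply, Pi.smul_apply, Pi.sub_apply, smul_eq_mul]; ring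
      rw [e1]
      have := mul_pos h0 hrpos
      have := mul_nonneg (sub_nonneg.2 h1) hqe
      linarith
  · have d1 : (affineSpan ℝ (pmPolytope G)).direction = degDir G := by
      refine direction_eq _ _ p hpP (fun y hy => ((hPQ y).1 hy).1) fun d hd => ?_
      obtain ⟨ε, h0, _, h2⟩ := small_step Finset.univ φ b p d (fun j _ => hpstrict j)
      refine ⟨ε, h0, (hPQ _).2 ⟨?_, fun j => h2 j (Finset.mem_univ j)⟩⟩
      rw [add_sub_cancel_left]
      exact (degDir G).smul_mem _ hd
    have d2 : (affineSpan ℝ {y ∈ pmPolytope G | cutL G (U : Set V) y = 1}).direction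
        = degDir G ⊓ LinearMap.ker (cutL G (U : Set V)) := by
      refine direction_eq _ _ q ⟨hqP, hqi⟩ ?_ ?_
      · rintro y ⟨hy, hy1⟩
        refine ⟨sub_mem_degDir G (pm_subset_bip G hqP) (pm_subset_bip G hy), ?_⟩
        change cutL G (U : Set V) (y - q) = 0
        rw [map_sub, hy1, hqi, sub_self]
      · rintro d ⟨hd, hd0⟩
        have hd0 : cutL G (U : Set V) d = 0 := hd0
        obtain ⟨ε, h0, _, h2⟩ := hqd d hd hd0
        exact ⟨ε, h0, h2, by rw [map_add, map_smul, hqi, hd0]; simp⟩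
    unfold affDim
    rw [d1, d2]
    refine finrank_inf_ker _ _ ⟨x - p, sub_mem_degDir G hpb hxb, ?_⟩
    rw [map_sub]
    linarith
end

section
/- Let G be a brace that is not isomorphic to the 4-cycle C₄, and let e be an edge of G. Then the face F = {x ∈ PM(G) : x_e = 0} is nonempty with the dimension of its affine span equal to the dimension of the affine span of PM(G) minus 1, if and only if the graph G − e obtained by deleting the edge e is matching covered. -/
open BigOperators

variable {V : Type*}

/-- A brace: a bipartite matching covered graph with no nontrivial tight cut. -/
def IsBrace [Fintype V] (G : SimpleGraph V) : Prop :=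
  MatchingCovered G ∧ G.Colorable 2 ∧
    ∀ U : Set V, IsTightCut G U → ¬(2 ≤ U.ncard ∧ 2 ≤ Uᶜ.ncard)

/-- A perfect matching presented as an involution. -/
def IsM (G : SimpleGraph V) (m : V → V) : Prop :=
  (∀ v, G.Adj v (m v)) ∧ ∀ v, m (m v) = v

lemma IsM.of_pm {G : SimpleGraph V} {M : G.Subgraph} (h : M.IsPerfectMatching) :
    ∃ m, IsM G m ∧ ∀ a b, M.Adj a b ↔ m a = b := by
  rw [SimpleGraph.Subgraph.isPerfectMatching_iff] at h
  choose m hm hu using h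
  have key : ∀ a b, M.Adj a b ↔ m a = b := by
    intro a b
    constructor
    · intro hab
      exact (hu a b hab).symm
    · rintro rfl
      exact hm a
  refine ⟨m, ⟨fun v => (hm v).adj_sub, fun v => ?_⟩, key⟩
  exact (key _ _).1 (hm v).symm

lemma IsM.to_pm {G : SimpleGraph V} {m : V → V} (h : IsM G m) :
    ∃ M : G.Subgraph, M.IsPerfectMatching ∧ ∀ a b, M.Adj a b ↔ m a = b := by
  refine ⟨{ verts := Set.univ, Adj := fun a b => m a = b, adj_sub := ?_, edge_vert := ?_,
            symm := ?_ }, ?_, fun a b => Iff.rfl⟩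
  · rintro a b rfl
    exact h.1 a
  · intros
    trivial
  · constructor
    rintro a b rfl
    exact h.2 a
  · rw [SimpleGraph.Subgraph.isPerfectMatching_iff]
    intro v
    exact ⟨m v, rfl, fun y hy => Eq.symm hy⟩

lemma IsM.even_filter [DecidableEq V] {G : SimpleGraph V} {m : V → V} (h : IsM G m)
    (U : Finset V) : Even (U.filter (fun a => m a ∈ U)).card := by
  have : ∑ a ∈ U.filter (fun a => m a ∈ U), (1 : ZMod 2) = 0 := by
    refine Finset.sum_involution (fun a _ => m a) ?_ ?_ ?_ ?_
    · intros
      decide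
    · intro a _ _ ha
      exact (h.1 a).ne ha.symm
    · intro a ha
      simp only [Finset.mem_filter] at ha ⊢
      exact ⟨ha.2, by rw [h.2]; exact ha.1⟩
    · intro a _
      exact h.2 a
  simp only [Finset.sum_const, nsmul_eq_mul, mul_one] at this
  exact (ZMod.natCast_eq_zero_iff_even).1 this

lemma IsM.parity [DecidableEq V] {G : SimpleGraph V} {m : V → V} (h : IsM G m)
    (U : Finset V) : Even U.card ↔ Even (U.filter (fun a => m a ∉ U)).card := by
  have h1 := h.even_filter U
  have h2 := Finset.card_filter_add_card_filter_not (s := U) (fun a => m a ∈ U)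
  rw [← h2, Nat.even_add]
  tauto

lemma IsM.even_card [Fintype V] [DecidableEq V] {G : SimpleGraph V} {m : V → V} (h : IsM G m) :
    Even (Fintype.card V) := by
  have := h.even_filter Finset.univ
  simpa using this

lemma brace_no_tight [Fintype V] [DecidableEq V] {G : SimpleGraph V} (hB : IsBrace G)
    (hev : Even (Fintype.card V))
    (U : Finset V) (hodd : Odd U.card) (h2 : 2 ≤ U.card) (h2' : U.card + 2 ≤ Fintype.card V)
    (ht : ∀ m, IsM G m → (U.filter (fun a => m a ∉ U)).card = 1) : False := by
  have hc : ((U : Set V)ᶜ).ncard = Fintype.card V - U.card := by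
    rw [← Finset.coe_compl, Set.ncard_coe_finset, Finset.card_compl]
  refine hB.2.2 (U : Set V) ⟨⟨by simpa using hodd, ?_⟩, ?_⟩ ⟨by simpa using h2, by omega⟩
  · rw [hc]
    obtain ⟨k, hk⟩ := hodd
    obtain ⟨l, hl⟩ := hev
    exact ⟨l - k - 1, by omega⟩
  · intro M hM
    obtain ⟨m, hm, hmM⟩ := IsM.of_pm hM
    have : M.edgeSet ∩ cutSet G (U : Set V)
        = (fun a => s(a, m a)) '' ((U.filter (fun a => m a ∉ U) : Finset V) : Set V) := by
      ext e
      simp only [Set.mem_inter_iff, cutSet, Set.mem_ofPred_eq, Set.mem_image, Finset.coe_filter]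
      constructor
      · rintro ⟨he, -, a, b, rfl, ha, hb⟩
        rw [SimpleGraph.Subgraph.mem_edgeSet, hmM] at he
        subst he
        exact ⟨a, ⟨ha, hb⟩, rfl⟩
      · rintro ⟨a, ⟨ha, hb⟩, rfl⟩
        refine ⟨?_, hm.1 a, a, m a, rfl, ha, hb⟩
        rw [SimpleGraph.Subgraph.mem_edgeSet, hmM]
    rw [this, Set.InjOn.ncard_image, Set.ncard_coe_finset, ht m hm]
    intro a ha b hb hab
    simp only [Finset.coe_filter, Set.mem_ofPred_eq] at ha hb
    simp only [Sym2.eq_iff] at hab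
    rcases hab with h | h
    · exact h.1
    · exact absurd (h.1 ▸ ha.1) hb.2

lemma mc_exists_m {G : SimpleGraph V} (hG : MatchingCovered G) {a b : V} (hab : G.Adj a b) :
    ∃ m, IsM G m ∧ m a = b := by
  obtain ⟨M, hM, he⟩ := hG.2.2 s(a, b) hab
  obtain ⟨m, hm, hmM⟩ := IsM.of_pm hM
  exact ⟨m, hm, (hmM a b).1 he⟩

lemma mc_exists_m' {G : SimpleGraph V} (hG : MatchingCovered G) : ∃ m, IsM G m := by
  obtain ⟨e, he⟩ := hG.2.1
  induction e with
  | _ a b =>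
    obtain ⟨m, hm, _⟩ := mc_exists_m hG he
    exact ⟨m, hm⟩

lemma exists_crossing {G : SimpleGraph V} (hG : G.Connected) (S : Finset V) {u v : V}
    (hu : u ∈ S) (hv : v ∉ S) : ∃ a b, G.Adj a b ∧ a ∈ S ∧ b ∉ S := by
  obtain ⟨p⟩ := hG.preconnected u v
  obtain ⟨d, _, h1, h2⟩ := p.exists_boundary_dart (S : Set V) hu hv
  exact ⟨d.fst, d.snd, d.adj, h1, h2⟩

/-- crossing edges of `S` lie in `{e, f}` : the number of crossing matching edges is at most 2 -/
lemma crossing_le_two [DecidableEq V] {G : SimpleGraph V} {m : V → V} (hm : IsM G m)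
    (S : Finset V) (e f : Sym2 V)
    (hS : ∀ a b, G.Adj a b → a ∈ S → b ∉ S → s(a, b) = e ∨ s(a, b) = f) :
    (S.filter (fun a => m a ∉ S)).card ≤ 2 := by
  refine le_trans (Finset.card_le_card_of_injOn (t := {e, f}) (fun a => s(a, m a)) ?_ ?_)
    Finset.card_le_two
  · intro a ha
    simp only [Finset.coe_filter, Set.mem_ofPred_eq] at ha
    simpa using hS a (m a) (hm.1 a) ha.1 ha.2
  · intro a ha b hb hab
    simp only [Finset.coe_filter, Set.mem_ofPred_eq] at ha hb
    simp only [Sym2.eq_iff] at hab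
    rcases hab with h | h
    · exact h.1
    · exact absurd (h.1 ▸ ha.1) hb.2

lemma even_case [Fintype V] [DecidableEq V] {G : SimpleGraph V} (hB : IsBrace G)
    (S : Finset V) (e f : Sym2 V) (hev : Even S.card) (h3 : 3 ≤ S.card)
    {v : V} (hv : v ∉ S)
    (hS : ∀ a b, G.Adj a b → a ∈ S → b ∉ S → s(a, b) = e ∨ s(a, b) = f) : False := by
  obtain ⟨m0, hm0⟩ := mc_exists_m' hB.1
  obtain ⟨u, hu⟩ : S.Nonempty := Finset.card_pos.1 (by omega)
  obtain ⟨a1, b1, hadj, ha1, hb1⟩ := exists_crossing hB.1.1 S hu hv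
  wlog he : s(a1, b1) = e generalizing e f
  · refine this f e (fun a b h1 h2 h3 => (hS a b h1 h2 h3).symm) ?_
    exact (hS _ _ hadj ha1 hb1).resolve_left he
  have hlt : S.card < Fintype.card V := Finset.card_lt_univ_of_notMem hv
  have hce := Finset.card_erase_of_mem ha1
  refine brace_no_tight hB hm0.even_card (S.erase a1) ?_ (by omega) (by omega) ?_
  · rw [hce]
    exact Nat.Even.sub_odd (by omega) hev odd_one
  intro m hm
  have hle := crossing_le_two hm S e f hS
  have hpar := (hm.parity S).1 hev
  by_cases h1 : m a1 ∈ S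
  · have hX : S.filter (fun a => m a ∉ S) = ∅ := by
      have : (S.filter (fun a => m a ∉ S)).card ≤ 1 := by
        rw [Finset.card_le_one]
        have key : ∀ a ∈ S.filter (fun a => m a ∉ S), s(a, m a) = f := by
          intro a ha
          rw [Finset.mem_filter] at ha
          refine (hS a (m a) (hm.1 a) ha.1 ha.2).resolve_left ?_
          intro h
          rw [← he, Sym2.eq_iff] at h
          rcases h with h | h
          · exact ha.2 (h.1 ▸ h1)
          · exact hb1 (h.1 ▸ ha.1)
        intro a ha b hb
        have hab := (key a ha).trans (key b hb).symm
        rw [Finset.mem_filter] at ha hb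
        rw [Sym2.eq_iff] at hab
        rcases hab with h | h
        · exact h.1
        · exact absurd (h.1 ▸ ha.1) hb.2
      rw [← Finset.card_eq_zero]
      obtain ⟨k, hk⟩ := hpar
      omega
    have : (S.erase a1).filter (fun a => m a ∉ S.erase a1) = {m a1} := by
      ext a
      simp only [Finset.mem_filter, Finset.mem_erase, Finset.mem_singleton]
      constructor
      · rintro ⟨⟨h2, h3⟩, h4⟩
        have h5 : m a ∈ S := by
          by_contra h5
          have : a ∈ S.filter (fun a => m a ∉ S) := Finset.mem_filter.2 ⟨h3, h5⟩
          rw [hX] at this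
          simp at this
        have h6 : m a = a1 := by
          by_contra h6
          exact h4 ⟨h6, h5⟩
        rw [← h6, hm.2]
      · rintro rfl
        refine ⟨⟨(hm.1 a1).ne', h1⟩, ?_⟩
        rw [hm.2]
        simp
    rw [this, Finset.card_singleton]
  · have ha1X : a1 ∈ S.filter (fun a => m a ∉ S) := Finset.mem_filter.2 ⟨ha1, h1⟩
    have hpos : 0 < (S.filter (fun a => m a ∉ S)).card := Finset.card_pos.2 ⟨_, ha1X⟩
    have : (S.erase a1).filter (fun a => m a ∉ S.erase a1)
        = (S.filter (fun a => m a ∉ S)).erase a1 := by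
      ext a
      simp only [Finset.mem_filter, Finset.mem_erase]
      constructor
      · rintro ⟨⟨h2, h3⟩, h4⟩
        refine ⟨h2, h3, fun h5 => h4 ⟨?_, h5⟩⟩
        intro h6
        apply h1
        rw [← h6, hm.2]
        exact h3
      · rintro ⟨h2, h3, h4⟩
        exact ⟨⟨h2, h3⟩, fun h => h4 h.2⟩
    rw [this, Finset.card_erase_of_mem ha1X]
    obtain ⟨k, hk⟩ := hpar
    omega

lemma exists_color {G : SimpleGraph V} (h : G.Colorable 2) :
    ∃ c : V → Bool, ∀ a b, G.Adj a b → c b = !(c a) := by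
  obtain ⟨C⟩ := h
  refine ⟨fun v => decide (C v = 0), fun a b hab => ?_⟩
  have := C.valid hab
  revert this
  show C a ≠ C b → decide (C b = 0) = !(decide (C a = 0))
  generalize C a = x
  generalize C b = y
  revert x y
  decide

lemma color_class_card [Fintype V] [DecidableEq V] {G : SimpleGraph V} {c : V → Bool}
    (hc : ∀ a b, G.Adj a b → c b = !(c a)) {m : V → V} (hm : IsM G m) (x : Bool) :
    2 * (Finset.univ.filter (fun v => c v = x)).card = Fintype.card V := by
  have h1 : (Finset.univ.filter (fun v => c v = x)).card
      = (Finset.univ.filter (fun v => ¬ c v = x)).card := by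
    refine Finset.card_bij' (fun a _ => m a) (fun a _ => m a) ?_ ?_ ?_ ?_
    · intro a ha
      have := hc _ _ (hm.1 a)
      simp_all
    · intro a ha
      have := hc _ _ (hm.1 a)
      simp only [Finset.mem_filter, Finset.mem_univ, true_and] at ha ⊢
      rw [this]
      revert ha
      generalize c a = y
      revert x y
      decide
    · intro a _
      exact hm.2 a
    · intro a _
      exact hm.2 a
  have h2 := Finset.card_filter_add_card_filter_not (s := Finset.univ) (fun v => c v = x)
  rw [Finset.card_univ] at h2
  omega

lemma degree_case [Fintype V] [DecidableEq V] {G : SimpleGraph V} (hB : IsBrace G)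
    (h6 : 6 ≤ Fintype.card V) (v : V) (e f : Sym2 V)
    (hS : ∀ b, G.Adj v b → s(v, b) = e ∨ s(v, b) = f) : False := by
  classical
  obtain ⟨m0, hm0⟩ := mc_exists_m' hB.1
  obtain ⟨c, hc⟩ := exists_color hB.2.1
  have hcard := color_class_card hc hm0 (!(c v))
  have hN : (Finset.univ.filter (fun b => G.Adj v b)).card ≤ 2 := by
    refine le_trans (Finset.card_le_card_of_injOn (t := {e, f}) (fun a => s(v, a)) ?_ ?_)
      Finset.card_le_two
    · intro a ha
      simp only [Finset.coe_filter, Finset.mem_univ, true_and, Set.mem_ofPred_eq] at ha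
      simpa using hS a ha
    · intro a ha b hb hab
      exact Sym2.congr_right.1 hab
  obtain ⟨T, hT1, hT2, hT3⟩ := Finset.exists_subsuperset_card_eq
    (s := Finset.univ.filter (fun b => G.Adj v b))
    (t := Finset.univ.filter (fun w => c w = !(c v))) (n := 2)
    (by
      intro b hb
      simp only [Finset.mem_filter, Finset.mem_univ, true_and] at hb ⊢
      exact hc _ _ hb) hN (by omega)
  have hTc : ∀ t ∈ T, c t = !(c v) := by
    intro t ht
    simpa using hT2 ht
  have hvT : v ∉ T := by
    intro h
    have := hTc v h
    simp at this
  have hUc : (insert v T).card = 3 := by rw [Finset.card_insert_of_notMem hvT, hT3]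
  refine brace_no_tight hB hm0.even_card (insert v T) ?_ (by omega) (by omega) ?_
  · rw [hUc]
    decide
  intro m hm
  have hmv : m v ∈ T := hT1 (by simpa using hm.1 v)
  have : (insert v T).filter (fun a => m a ∉ insert v T) = T.erase (m v) := by
    ext a
    simp only [Finset.mem_filter, Finset.mem_insert, Finset.mem_erase]
    constructor
    · rintro ⟨rfl | h2, h3⟩
      · exact absurd (Or.inr hmv) h3
      · refine ⟨?_, h2⟩
        rintro rfl
        exact h3 (Or.inl (hm.2 v))
    · rintro ⟨h2, h3⟩
      refine ⟨Or.inr h3, ?_⟩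
      rintro (h4 | h4)
      · apply h2
        rw [← h4, hm.2]
      · have h5 := hTc _ h4
        rw [hc _ _ (hm.1 a), hTc a h3] at h5
        simp at h5
  rw [this, Finset.card_erase_of_mem hmv, hT3]

lemma no_two_cut [Fintype V] [DecidableEq V] {G : SimpleGraph V} (hB : IsBrace G)
    (h6 : 6 ≤ Fintype.card V) (S : Finset V) (e f : Sym2 V) {u v : V} (hu : u ∈ S) (hv : v ∉ S)
    (hS : ∀ a b, G.Adj a b → a ∈ S → b ∉ S → s(a, b) = e ∨ s(a, b) = f) : False := by
  obtain ⟨m0, hm0⟩ := mc_exists_m' hB.1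
  have hev := hm0.even_card
  have hSc : ∀ a b, G.Adj a b → a ∈ Sᶜ → b ∉ Sᶜ → s(a, b) = e ∨ s(a, b) = f := by
    intro a b hab ha hb
    rw [Sym2.eq_swap]
    simp only [Finset.mem_compl, not_not] at ha hb
    exact hS b a hab.symm hb ha
  have hcc := Finset.card_compl_add_card S
  have hpos : 0 < S.card := Finset.card_pos.2 ⟨u, hu⟩
  have hlt : S.card < Fintype.card V := Finset.card_lt_univ_of_notMem hv
  by_cases hSe : Even S.card
  · by_cases h3 : 3 ≤ S.card
    · exact even_case hB S e f hSe h3 hv hS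
    · refine even_case hB Sᶜ e f ?_ (by omega) (v := u) (by simpa using hu) hSc
      rw [Finset.card_compl]
      exact (Nat.even_sub hlt.le).2 (by simp [hev, hSe])
  · have key : ∀ m, IsM G m → (S.filter (fun a => m a ∉ S)).card = 1 := by
      intro m hm
      have h1 := crossing_le_two hm S e f hS
      have h2 := (hm.parity S).not.1 hSe
      interval_cases h : (S.filter (fun a => m a ∉ S)).card
      · simp at h2
      · rfl
      · simp at h2
    by_cases h1 : S.card = 1
    · obtain ⟨x, hx⟩ := Finset.card_eq_one.1 h1
      refine degree_case hB h6 x e f (fun b hb => hS x b hb (by simp [hx]) ?_)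
      simp [hx, hb.ne']
    by_cases h1' : Sᶜ.card = 1
    · obtain ⟨x, hx⟩ := Finset.card_eq_one.1 h1'
      refine degree_case hB h6 x e f (fun b hb => hSc x b hb (by simp [hx]) ?_)
      simp [hx, hb.ne']
    exact brace_no_tight hB hev S (Nat.not_even_iff_odd.1 hSe) (by omega) (by omega) key

lemma brace_reachable [Fintype V] [DecidableEq V] {G : SimpleGraph V} (hB : IsBrace G)
    (h6 : 6 ≤ Fintype.card V) (e f : Sym2 V) (u v : V) :
    (G.deleteEdges {e, f}).Reachable u v := by
  classical
  by_contra hr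
  refine no_two_cut hB h6 (Finset.univ.filter (fun w => (G.deleteEdges {e, f}).Reachable u w))
    e f (u := u) (v := v) (by simp) (by simpa using hr) ?_
  intro a b hab ha hb
  simp only [Finset.mem_filter, Finset.mem_univ, true_and] at ha hb
  by_contra hne
  apply hb
  refine ha.trans (SimpleGraph.Adj.reachable ?_)
  rw [SimpleGraph.deleteEdges_adj]
  exact ⟨hab, by simpa using hne⟩

lemma four_case [Fintype V] [DecidableEq V] {G : SimpleGraph V} (hB : IsBrace G)
    (h4 : Fintype.card V = 4) : Nonempty (G ≃g SimpleGraph.cycleGraph 4) := by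
  obtain ⟨m, hm⟩ := mc_exists_m' hB.1
  obtain ⟨c, hc⟩ := exists_color hB.2.1
  have hA := color_class_card hc hm true
  have hA2 : (Finset.univ.filter (fun v => c v = true)).card = 2 := by omega
  obtain ⟨a1, a2, h12, hAeq⟩ := Finset.card_eq_two.1 hA2
  have hmem : ∀ v, c v = true ↔ v = a1 ∨ v = a2 := by
    intro v
    have : v ∈ Finset.univ.filter (fun v => c v = true) ↔ v ∈ ({a1, a2} : Finset V) := by
      rw [hAeq]
    simpa using this
  have hc1 : c a1 = true := (hmem _).2 (Or.inl rfl)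
  have hc2 : c a2 = true := (hmem _).2 (Or.inr rfl)
  have hcover : ∀ v, v = a1 ∨ v = a2 ∨ v = m a1 ∨ v = m a2 := by
    intro v
    by_cases h : c v = true
    · rcases (hmem v).1 h with h | h <;> simp [h]
    · have h' : c (m v) = true := by
        rw [hc _ _ (hm.1 v)]
        simpa using h
      rcases (hmem _).1 h' with h | h
      · right; right; left
        rw [← h, hm.2]
      · right; right; right
        rw [← h, hm.2]
  have hd1 : c (m a1) = false := by rw [hc _ _ (hm.1 a1), hc1]; rfl
  have hd2 : c (m a2) = false := by rw [hc _ _ (hm.1 a2), hc2]; rfl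
  have hne : m a1 ≠ m a2 := by
    intro h
    apply h12
    rw [← hm.2 a1, h, hm.2]
  have hiff : G.Adj a1 (m a2) ↔ G.Adj a2 (m a1) := by
    have gen : ∀ x y, (∀ v, c v = true → v = x ∨ v = y) → c x = true → c y = true → x ≠ y →
        m x ≠ m y → G.Adj x (m y) → G.Adj y (m x) := by
      intro x y hxy hx hy hne hnm hadj
      obtain ⟨m', hm', hmx⟩ := mc_exists_m hB.1 hadj
      have h1 : c (m' (m x)) = true := by
        rw [hc _ _ (hm'.1 _), hc _ _ (hm.1 _), hx]
        rfl
      have h2 : m' (m x) = y := by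
        refine (hxy _ h1).resolve_left ?_
        intro h
        apply hnm
        rw [← hmx]
        conv_rhs => rw [← h]
        exact (hm'.2 _).symm
      have := hm'.1 (m x)
      rw [h2] at this
      exact this.symm
    exact ⟨gen a1 a2 (fun v h => (hmem v).1 h) hc1 hc2 h12 hne,
      gen a2 a1 (fun v h => ((hmem v).1 h).symm) hc2 hc1 h12.symm hne.symm⟩
  have hsame : ∀ a b, c a = c b → ¬ G.Adj a b := by
    intro a b h hab
    have := hc _ _ hab
    rw [h] at this
    simp at this
  have hboth : G.Adj a1 (m a2) := by
    obtain ⟨x, y, hxy, hx, hy⟩ := exists_crossing hB.1.1 {a1, m a1} (u := a1) (v := a2) (by simp)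
      (by
        simp only [Finset.mem_insert, Finset.mem_singleton, not_or]
        refine ⟨h12.symm, ?_⟩
        intro h
        rw [← h, hc2] at hd1
        simp at hd1)
    simp only [Finset.mem_insert, Finset.mem_singleton, not_or] at hx hy
    rcases hx with rfl | rfl <;> rcases hcover y with rfl | rfl | rfl | rfl
    · exact absurd rfl hy.1
    · exact absurd hxy (hsame _ _ (by rw [hc1, hc2]))
    · exact absurd rfl hy.2
    · exact hxy
    · exact absurd rfl hy.1
    · exact hiff.2 hxy.symm
    · exact absurd rfl hy.2
    · exact absurd hxy (hsame _ _ (by rw [hd1, hd2]))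
  have hboth' := hiff.1 hboth
  let g : Fin 4 → V := ![a1, m a1, a2, m a2]
  have hinj : Function.Surjective g := by
    intro v
    rcases hcover v with rfl | rfl | rfl | rfl
    · exact ⟨0, rfl⟩
    · exact ⟨2, rfl⟩
    · exact ⟨1, rfl⟩
    · exact ⟨3, rfl⟩
  have hbij : Function.Bijective g :=
    (Fintype.bijective_iff_surjective_and_card g).2 ⟨hinj, by simp [h4]⟩
  have hadj : ∀ i j, G.Adj (g i) (g j) ↔ (SimpleGraph.cycleGraph 4).Adj i j := by
    have e1 := hm.1 a1
    have e2 := hm.1 a2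
    have n1 := hsame a1 a2 (by rw [hc1, hc2])
    have n2 := hsame (m a1) (m a2) (by rw [hd1, hd2])
    have n1' : ¬ G.Adj a2 a1 := fun h => n1 h.symm
    have n2' : ¬ G.Adj (m a2) (m a1) := fun h => n2 h.symm
    intro i j
    fin_cases i <;> fin_cases j <;>
      simp [g, SimpleGraph.cycleGraph_adj, e1, e2, n1, n2, n1', n2', hboth, hboth', e1.symm,
        e2.symm, hboth.symm, hboth'.symm] <;> decide
  exact ⟨(⟨Equiv.ofBijective g hbij, fun {i j} => hadj i j⟩ :
    SimpleGraph.cycleGraph 4 ≃g G).symm⟩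

lemma incVecR_apply [DecidableEq V] {G : SimpleGraph V} {M : G.Subgraph} {m : V → V}
    (h : ∀ a b, M.Adj a b ↔ m a = b) (a b : V) :
    incVecR G M s(a, b) = if m a = b then 1 else 0 := by
  unfold incVecR
  rw [SimpleGraph.Subgraph.mem_edgeSet]
  simp only [h]

lemma incVecR_mem {G : SimpleGraph V} {M : G.Subgraph} (h : M.IsPerfectMatching) :
    incVecR G M ∈ pmPolytope G :=
  subset_convexHull ℝ _ ⟨M, h, rfl⟩

lemma mem_pmPolytope [Fintype V] [DecidableEq V] {G : SimpleGraph V} {x : Sym2 V → ℝ}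
    (hx : x ∈ pmPolytope G) :
    (∀ e, 0 ≤ x e) ∧ (∀ e, e ∉ G.edgeSet → x e = 0) ∧ ∀ v : V, ∑ w, x s(v, w) = 1 := by
  refine convexHull_min (t := {x : Sym2 V → ℝ | (∀ e, 0 ≤ x e) ∧
    (∀ e, e ∉ G.edgeSet → x e = 0) ∧ ∀ v : V, ∑ w, x s(v, w) = 1}) ?_ ?_ hx
  · rintro _ ⟨M, hM, rfl⟩
    obtain ⟨m, hm, hmM⟩ := IsM.of_pm hM
    refine ⟨fun e => ?_, fun e he => ?_, fun v => ?_⟩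
    · unfold incVecR
      split_ifs <;> norm_num
    · unfold incVecR
      rw [if_neg (fun h => he (M.edgeSet_subset h))]
    · simp [incVecR_apply hmM]
  · rintro x ⟨h1, h2, h3⟩ y ⟨k1, k2, k3⟩ a b ha hb hab
    refine ⟨fun e => ?_, fun e he => ?_, fun v => ?_⟩
    · have := mul_nonneg ha (h1 e)
      have := mul_nonneg hb (k1 e)
      simp only [Pi.add_apply, Pi.smul_apply, smul_eq_mul]
      linarith
    · simp [h2 e he, k2 e he]
    · simp only [Pi.add_apply, Pi.smul_apply, smul_eq_mul]
      rw [Finset.sum_add_distrib, ← Finset.mul_sum, ← Finset.mul_sum, h3, k3]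
      linarith

/-- Birkhoff's theorem for bipartite graphs. -/
lemma birkhoff_graph [Fintype V] [DecidableEq V] {G : SimpleGraph V} {c : V → Bool}
    (hc : ∀ a b, G.Adj a b → c b = !(c a)) {x : Sym2 V → ℝ}
    (h0 : ∀ e, 0 ≤ x e) (hs : ∀ e, e ∉ G.edgeSet → x e = 0)
    (h1 : ∀ v : V, ∑ w, x s(v, w) = 1) : x ∈ pmPolytope G := by
  let X : Matrix V V ℝ := fun v w => x s(v, w)
  have hX : X ∈ doublyStochastic ℝ V := by
    rw [mem_doublyStochastic_iff_sum]
    refine ⟨fun i j => h0 _, fun i => h1 i, fun j => ?_⟩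
    rw [← h1 j]
    exact Finset.sum_congr rfl (fun i _ => by simp only [X]; rw [Sym2.eq_swap])
  obtain ⟨w, hw0, hw1, hwX⟩ := exists_eq_sum_perm_of_mem_doublyStochastic hX
  have hXe : ∀ a b, x s(a, b) = ∑ σ : Equiv.Perm V, w σ * (if σ a = b then 1 else 0) := by
    intro a b
    have : X a b = (∑ σ, w σ • Equiv.Perm.permMatrix ℝ σ) a b := by rw [hwX]
    simp only [X] at this
    rw [this, Matrix.sum_apply]
    refine Finset.sum_congr rfl (fun σ _ => ?_)
    simp [PEquiv.toMatrix_apply, Equiv.toPEquiv_apply, eq_comm]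
  have hadj : ∀ σ, w σ ≠ 0 → ∀ a, G.Adj a (σ a) := by
    intro σ hσ a
    by_contra hna
    have h2 := hXe a (σ a)
    rw [hs _ hna] at h2
    have h3 := (Finset.sum_eq_zero_iff_of_nonneg (fun τ _ => by
      have := hw0 τ
      split_ifs <;> simp [this])).1 h2.symm σ (Finset.mem_univ _)
    simp at h3
    exact hσ h3
  let ms : Equiv.Perm V → V → V := fun σ v => if c v then σ v else σ.symm v
  have hms : ∀ σ, w σ ≠ 0 → IsM G (ms σ) := by
    intro σ hσ
    have hA := hadj σ hσ
    have hA' : ∀ a, G.Adj a (σ.symm a) := by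
      intro a
      have := hA (σ.symm a)
      rw [Equiv.apply_symm_apply] at this
      exact this.symm
    refine ⟨fun v => ?_, fun v => ?_⟩
    · simp only [ms]
      split_ifs
      · exact hA v
      · exact hA' v
    · simp only [ms]
      by_cases h : c v = true
      · have := hc _ _ (hA v)
        simp [h, this]
      · have := hc _ _ (hA' v)
        simp [h, this]
  have hM : ∀ σ, w σ ≠ 0 → ∃ M : G.Subgraph, M.IsPerfectMatching ∧
      ∀ a b, M.Adj a b ↔ ms σ a = b := fun σ hσ => (hms σ hσ).to_pm
  have hz : ∀ σ, ∃ z : Sym2 V → ℝ, w σ ≠ 0 → (z ∈ pmPolytope G ∧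
      ∀ a b, z s(a, b) = if ms σ a = b then 1 else 0) := by
    intro σ
    by_cases hσ : w σ = 0
    · exact ⟨0, fun h => absurd hσ h⟩
    · obtain ⟨M, hM, hMm⟩ := hM σ hσ
      exact ⟨incVecR G M, fun _ => ⟨incVecR_mem hM, incVecR_apply hMm⟩⟩
  choose z hz using hz
  have hsum : x = ∑ σ ∈ Finset.univ.filter (fun σ => w σ ≠ 0), w σ • z σ := by
    have key : ∀ a b, c a = true →
        x s(a, b) = ∑ σ ∈ Finset.univ.filter (fun σ => w σ ≠ 0), w σ * z σ s(a, b) := by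
      intro a b hca
      rw [hXe, ← Finset.sum_filter_of_ne (p := fun σ => w σ ≠ 0)]
      · refine Finset.sum_congr rfl (fun σ hσ => ?_)
        rw [(hz σ (by simpa using hσ)).2]
        simp [ms, hca]
      · intro σ _ h h'
        simp [h'] at h
    ext f
    induction f with
    | _ a b =>
      rw [Finset.sum_apply]
      simp only [Pi.smul_apply, smul_eq_mul]
      by_cases ha : c a = true
      · exact key a b ha
      by_cases hb : c b = true
      · rw [Sym2.eq_swap]
        exact key b a hb
      have hna : s(a, b) ∉ G.edgeSet := by
        intro h
        have := hc a b h
        simp_all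
      rw [hs _ hna]
      refine (Finset.sum_eq_zero (fun σ hσ => ?_)).symm
      rw [(mem_pmPolytope (hz σ (by simpa using hσ)).1).2.1 _ hna, mul_zero]
  rw [hsum]
  refine (convex_convexHull ℝ _).sum_mem (fun σ _ => hw0 σ) ?_ ?_
  · rw [← hw1]
    exact Finset.sum_filter_ne_zero _
  · intro σ hσ
    exact (hz σ (by simpa using hσ)).1

lemma barycenter [Fintype V] [DecidableEq V] {G : SimpleGraph V} (hG : MatchingCovered G) :
    ∃ b ∈ pmPolytope G, ∃ δ : ℝ, 0 < δ ∧ ∀ f ∈ G.edgeSet, δ ≤ b f := by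
  classical
  have hM : ∀ f : Sym2 V, ∃ z ∈ pmPolytope G, f ∈ G.edgeSet → z f = 1 := by
    intro f
    by_cases hf : f ∈ G.edgeSet
    · obtain ⟨M, hM, he⟩ := hG.2.2 f hf
      exact ⟨_, incVecR_mem hM, fun _ => by simp [incVecR, he]⟩
    · obtain ⟨f', hf'⟩ := hG.2.1
      obtain ⟨M, hM, he⟩ := hG.2.2 f' hf'
      exact ⟨_, incVecR_mem hM, fun h => absurd h hf⟩
  choose z hz hzf using hM
  obtain ⟨f0, hf0⟩ := hG.2.1
  have hN : (0 : ℝ) < Fintype.card (Sym2 V) := by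
    exact_mod_cast Fintype.card_pos_iff.2 ⟨f0⟩
  refine ⟨∑ f : Sym2 V, (1 / (Fintype.card (Sym2 V) : ℝ)) • z f,
    (convex_convexHull ℝ _).sum_mem (fun f _ => by positivity) ?_ (fun f _ => hz f),
    1 / (Fintype.card (Sym2 V) : ℝ), by positivity, ?_⟩
  · rw [Finset.sum_const, Finset.card_univ, nsmul_eq_mul]
    field_simp
  · intro f hf
    rw [Finset.sum_apply]
    refine le_trans (le_of_eq ?_) (Finset.single_le_sum (f := fun g =>
      ((1 / (Fintype.card (Sym2 V) : ℝ)) • z g) f) (fun g _ => ?_) (Finset.mem_univ f))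
    · simp [hzf f hf]
    · have := (mem_pmPolytope (hz g)).1 f
      simp only [Pi.smul_apply, smul_eq_mul]
      positivity

lemma mem_vectorSpan_of_kernel [Fintype V] [DecidableEq V] {G : SimpleGraph V}
    (hG : MatchingCovered G) {c : V → Bool} (hc : ∀ a b, G.Adj a b → c b = !(c a))
    {y : Sym2 V → ℝ} (hs : ∀ e, e ∉ G.edgeSet → y e = 0)
    (h1 : ∀ v : V, ∑ w, y s(v, w) = 0) : y ∈ vectorSpan ℝ (pmPolytope G) := by
  obtain ⟨b, hb, δ, hδ, hbδ⟩ := barycenter hG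
  obtain ⟨b0, bs, b1⟩ := mem_pmPolytope hb
  let C : ℝ := ∑ f, |y f|
  have hC : 0 ≤ C := Finset.sum_nonneg (fun f _ => abs_nonneg _)
  have hyC : ∀ f, |y f| ≤ C := fun f =>
    Finset.single_le_sum (f := fun f => |y f|) (fun g _ => abs_nonneg _) (Finset.mem_univ f)
  have hε : 0 < δ / (C + 1) := by positivity
  have hmem : b + (δ / (C + 1)) • y ∈ pmPolytope G := by
    refine birkhoff_graph hc (fun f => ?_) (fun f hf => ?_) (fun v => ?_)
    · by_cases hf : f ∈ G.edgeSet
      · have h2 := hbδ f hf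
        have h3 : δ / (C + 1) * |y f| ≤ δ := by
          rw [div_mul_eq_mul_div, div_le_iff₀ (by positivity)]
          have := hyC f
          gcongr
          linarith
        have h4 : δ / (C + 1) * (-|y f|) ≤ δ / (C + 1) * y f :=
          mul_le_mul_of_nonneg_left (neg_abs_le _) hε.le
        simp only [Pi.add_apply, Pi.smul_apply, smul_eq_mul]
        linarith
      · simp [hs f hf, bs f hf]
    · simp [hs f hf, bs f hf]
    · simp only [Pi.add_apply, Pi.smul_apply, smul_eq_mul]
      rw [Finset.sum_add_distrib, ← Finset.mul_sum, h1, b1]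
      simp
  have := vsub_mem_vectorSpan ℝ hmem hb
  rw [vsub_eq_sub, add_sub_cancel_left] at this
  exact (Submodule.smul_mem_iff _ hε.ne').1 this

lemma vectorSpan_le_ker {F : Set (Sym2 V → ℝ)} (φ : (Sym2 V → ℝ) →ₗ[ℝ] ℝ) (r : ℝ)
    (h : ∀ x ∈ F, φ x = r) : vectorSpan ℝ F ≤ LinearMap.ker φ := by
  rw [vectorSpan, Submodule.span_le]
  rintro _ ⟨x, hx, y, hy, rfl⟩
  simp [h x hx, h y hy]

lemma finrank_inf_ker_s14 {E : Type*} [AddCommGroup E] [Module ℝ E] [FiniteDimensional ℝ E]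
    (D : Submodule ℝ E) (φ : E →ₗ[ℝ] ℝ) {z : E} (hz : z ∈ D) (hφ : φ z ≠ 0) :
    Module.finrank ℝ (D ⊓ LinearMap.ker φ : Submodule ℝ E) = Module.finrank ℝ D - 1 := by
  have hne : φ.domRestrict D ≠ 0 := by
    intro h
    apply hφ
    have := LinearMap.congr_fun h ⟨z, hz⟩
    simpa using this
  have h1 := Module.Dual.finrank_ker_add_one_of_ne_zero (f := φ.domRestrict D) hne
  have h2 : (LinearMap.ker (φ.domRestrict D)).map D.subtype = D ⊓ LinearMap.ker φ := by
    ext v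
    simp only [Submodule.mem_map, LinearMap.mem_ker, Submodule.mem_inf]
    constructor
    · rintro ⟨w, hw, rfl⟩
      exact ⟨w.2, hw⟩
    · rintro ⟨hv, hw⟩
      exact ⟨⟨v, hv⟩, hw, rfl⟩
  have h3 := (Submodule.equivMapOfInjective D.subtype D.injective_subtype
    (LinearMap.ker (φ.domRestrict D))).finrank_eq
  rw [← h2, ← h3]
  omega

/-- The sign of a colour. -/
def sgn (x : Bool) : ℝ := if x then 1 else -1

lemma sgn_not (x : Bool) : sgn (!x) = - sgn x := by
  cases x <;> simp [sgn]

lemma sgn_ne (x : Bool) : sgn x ≠ 0 := by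
  cases x <;> simp [sgn]

lemma single_boundary [Fintype V] [DecidableEq V] {a b : V} (hab : a ≠ b) (r : ℝ) (v : V) :
    ∑ w, (Pi.single s(a, b) r : Sym2 V → ℝ) s(v, w)
      = (if v = a then r else 0) + (if v = b then r else 0) := by
  have : ∀ w, (Pi.single s(a, b) r : Sym2 V → ℝ) s(v, w)
      = (if v = a then (if w = b then r else 0) else 0)
        + (if v = b then (if w = a then r else 0) else 0) := by
    intro w
    rw [Pi.single_apply]
    simp only [Sym2.eq_iff]
    by_cases h1 : v = a
    · subst h1
      simp [hab]
    · by_cases h2 : v = b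
      · subst h2
        simp [h1]
      · simp [h1, h2]
  simp only [this]
  rw [Finset.sum_add_distrib]
  by_cases h1 : v = a
  · subst h1
    simp [hab]
  · by_cases h2 : v = b
    · subst h2
      simp [h1]
    · simp [h1, h2]

lemma walk_vector [Fintype V] [DecidableEq V] {G : SimpleGraph V} {c : V → Bool}
    (hc : ∀ a b, G.Adj a b → c b = !(c a)) {u v : V} (p : G.Walk u v) :
    ∃ y : Sym2 V → ℝ, (∀ e, e ∉ G.edgeSet → y e = 0) ∧
      ∀ w : V, ∑ t, y s(w, t) = (if w = u then sgn (c u) else 0) - (if w = v then sgn (c v) else 0) := by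
  induction p with
  | nil => exact ⟨0, by simp, by simp⟩
  | @cons a b d hab p ih =>
    obtain ⟨y, hy1, hy2⟩ := ih
    refine ⟨Pi.single s(a, b) (sgn (c a)) + y, fun e he => ?_, fun w => ?_⟩
    · have : e ≠ s(a, b) := by
        rintro rfl
        exact he hab
      simp [hy1 e he, this]
    · simp only [Pi.add_apply]
      rw [Finset.sum_add_distrib, hy2, single_boundary hab.ne, hc _ _ hab, sgn_not]
      split_ifs <;> ring

lemma IsM.delete {G : SimpleGraph V} {m : V → V} (hm : IsM G m) {e : Sym2 V}
    (h : ∀ a, s(a, m a) ≠ e) : IsM (G.deleteEdges {e}) m := by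
  refine ⟨fun v => ?_, hm.2⟩
  rw [SimpleGraph.deleteEdges_adj]
  exact ⟨hm.1 v, by simpa using h v⟩

lemma delete_pm_incVec {G : SimpleGraph V} {e : Sym2 V} {M : (G.deleteEdges {e}).Subgraph}
    (hM : M.IsPerfectMatching) : incVecR (G.deleteEdges {e}) M ∈ pmPolytope G := by
  classical
  obtain ⟨m, hm, hmM⟩ := IsM.of_pm hM
  have hm' : IsM G m := ⟨fun v => (SimpleGraph.deleteEdges_adj.1 (hm.1 v)).1, hm.2⟩
  obtain ⟨M', hM', hmM'⟩ := hm'.to_pm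
  have : incVecR (G.deleteEdges {e}) M = incVecR G M' := by
    ext f
    induction f with
    | _ a b => rw [incVecR_apply hmM, incVecR_apply hmM']
  rw [this]
  exact incVecR_mem hM'

lemma facet_forward [Fintype V] [DecidableEq V]
    (G : SimpleGraph V) (hBrace : IsBrace G)
    (hC4 : ¬ Nonempty (G ≃g SimpleGraph.cycleGraph 4))
    (e : Sym2 V) (he : e ∈ G.edgeSet)
    (hne : {x ∈ pmPolytope G | x e = 0}.Nonempty)
    (hdim : affDim {x ∈ pmPolytope G | x e = 0} = affDim (pmPolytope G) - 1) :
    MatchingCovered (G.deleteEdges {e}) := by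
  classical
  obtain ⟨c, hc⟩ := exists_color hBrace.2.1
  -- a perfect matching avoiding `e`
  obtain ⟨M0, hM0, he0⟩ : ∃ M : G.Subgraph, M.IsPerfectMatching ∧ e ∉ M.edgeSet := by
    by_contra hcon
    push Not at hcon
    obtain ⟨x, hx, hxe⟩ := hne
    have : x ∈ {x : Sym2 V → ℝ | x e = 1} := by
      refine convexHull_min ?_ ?_ hx
      · rintro _ ⟨M, hM, rfl⟩
        simp [incVecR, hcon M hM]
      · intro x hx y hy a b _ _ hab
        simp only [Set.mem_ofPred_eq] at hx hy ⊢
        simp [hx, hy, hab]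
    simp only [Set.mem_ofPred_eq] at this
    rw [hxe] at this
    norm_num at this
  obtain ⟨m0, hm0, hmM0⟩ := IsM.of_pm hM0
  have hav : ∀ a, s(a, m0 a) ≠ e := by
    rintro a rfl
    exact he0 ((hmM0 _ _).2 rfl)
  have hev := hm0.even_card
  have h6 : 6 ≤ Fintype.card V := by
    have h4 : Fintype.card V ≠ 4 := fun h => hC4 (four_case hBrace h)
    obtain ⟨k, hk⟩ := hev
    have h3 : 2 < Fintype.card V := by
      induction e with
      | _ a b =>
        rw [Fintype.two_lt_card_iff]
        refine ⟨a, b, m0 a, SimpleGraph.Adj.ne he, (hm0.1 a).ne, ?_⟩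
        intro h
        exact hav a (by rw [← h])
    omega
  have hreach := brace_reachable hBrace h6
  refine ⟨?_, ?_, ?_⟩
  · have : Nonempty V := Fintype.card_pos_iff.1 (by omega)
    refine ⟨fun u v => ?_⟩
    have := hreach e e u v
    simpa using this
  · induction e with
    | _ a b =>
      exact ⟨s(a, m0 a), (hm0.delete hav).1 a⟩
  · intro f hf
    induction f with
    | _ u v =>
    have hf' : G.Adj u v ∧ s(u, v) ≠ e := by simpa using hf
    obtain ⟨huv, hfe⟩ := hf'
    by_contra hcon
    have hcon' : ∀ m, IsM G m → m u = v → ∃ a, s(a, m a) = e := by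
      intro m hm hmu
      by_contra h
      push Not at h
      obtain ⟨M, hM, hMm⟩ := (hm.delete h).to_pm
      exact hcon ⟨M, hM, (hMm u v).2 hmu⟩
    -- points of the face vanish at `f`
    have hle : ∀ x ∈ pmPolytope G, x s(u, v) ≤ x e := by
      intro x hx
      have : x ∈ {x : Sym2 V → ℝ | x s(u, v) ≤ x e} := by
        refine convexHull_min ?_ ?_ hx
        · rintro _ ⟨M, hM, rfl⟩
          obtain ⟨m, hm, hmM⟩ := IsM.of_pm hM
          show incVecR G M s(u, v) ≤ incVecR G M e
          rw [incVecR_apply hmM]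
          split_ifs with h
          · obtain ⟨a, rfl⟩ := hcon' m hm h
            rw [incVecR_apply hmM, if_pos rfl]
          · exact (mem_pmPolytope (incVecR_mem hM)).1 e
        · intro x hx y hy a b ha hb hab
          simp only [Set.mem_ofPred_eq] at hx hy ⊢
          have := mul_le_mul_of_nonneg_left hx ha
          have := mul_le_mul_of_nonneg_left hy hb
          simp only [Pi.add_apply, Pi.smul_apply, smul_eq_mul]
          linarith
      exact this
    have hker_f := vectorSpan_le_ker (F := {x ∈ pmPolytope G | x e = 0})
      (LinearMap.proj s(u, v)) 0 (by
        rintro x ⟨hx, hxe⟩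
        have h1 := hle x hx
        have h2 := (mem_pmPolytope hx).1 s(u, v)
        rw [LinearMap.proj_apply]
        linarith)
    have hker_e := vectorSpan_le_ker (F := {x ∈ pmPolytope G | x e = 0})
      (LinearMap.proj e) 0 (by
        rintro x ⟨hx, hxe⟩
        exact hxe)
    have hmono : vectorSpan ℝ {x ∈ pmPolytope G | x e = 0} ≤ vectorSpan ℝ (pmPolytope G) :=
      vectorSpan_mono ℝ (fun x hx => hx.1)
    -- a vector in the span that is nonzero at `e`
    obtain ⟨M1, hM1, he1⟩ := hBrace.1.2.2 e he
    have hz := vsub_mem_vectorSpan ℝ (incVecR_mem hM1) (incVecR_mem hM0)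
    have hrank := finrank_inf_ker_s14 (vectorSpan ℝ (pmPolytope G)) (LinearMap.proj e) hz
      (by simp [incVecR, he1, he0])
    unfold affDim at hdim
    rw [direction_affineSpan, direction_affineSpan, ← hrank] at hdim
    have heq := Submodule.eq_of_le_of_finrank_eq (le_inf hmono hker_e) hdim
    -- the alternating vector of a cycle through `f` avoiding `e`
    obtain ⟨p⟩ := hreach e s(u, v) u v
    have hc' : ∀ a b, (G.deleteEdges {e, s(u, v)}).Adj a b → c b = !(c a) :=
      fun a b hab => hc a b (SimpleGraph.deleteEdges_adj.1 hab).1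
    obtain ⟨y, hy1, hy2⟩ := walk_vector hc' p
    have hye : y e = 0 := hy1 e (by simp)
    have hyf : y s(u, v) = 0 := hy1 s(u, v) (by simp)
    have hmem : y - Pi.single s(u, v) (sgn (c u)) ∈
        vectorSpan ℝ (pmPolytope G) ⊓ LinearMap.ker (LinearMap.proj e) := by
      refine ⟨mem_vectorSpan_of_kernel hBrace.1 hc (fun g hg => ?_) (fun w => ?_), ?_⟩
      · have h1 : g ≠ s(u, v) := by
          rintro rfl
          exact hg huv
        have h2 : y g = 0 := hy1 g (fun h => hg (SimpleGraph.edgeSet_mono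
          (SimpleGraph.deleteEdges_le _) h))
        simp [h1, h2]
      · simp only [Pi.sub_apply]
        rw [Finset.sum_sub_distrib, hy2, single_boundary huv.ne, hc _ _ huv, sgn_not]
        split_ifs <;> ring
      · simp [hye, hfe.symm]
    rw [← heq] at hmem
    have := hker_f hmem
    simp [hyf, sgn_ne] at this

lemma facet_backward [Fintype V] [DecidableEq V]
    (G : SimpleGraph V) (hBrace : IsBrace G)
    (e : Sym2 V) (he : e ∈ G.edgeSet)
    (hD : MatchingCovered (G.deleteEdges {e})) :
    {x ∈ pmPolytope G | x e = 0}.Nonempty ∧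
      affDim {x ∈ pmPolytope G | x e = 0} = affDim (pmPolytope G) - 1 := by
  classical
  obtain ⟨c, hc⟩ := exists_color hBrace.2.1
  have hc' : ∀ a b, (G.deleteEdges {e}).Adj a b → c b = !(c a) :=
    fun a b hab => hc a b (SimpleGraph.deleteEdges_adj.1 hab).1
  have hsub : pmPolytope (G.deleteEdges {e}) ⊆ {x ∈ pmPolytope G | x e = 0} := by
    intro x hx
    refine ⟨?_, (mem_pmPolytope hx).2.1 e (by simp)⟩
    refine convexHull_min ?_ (convex_convexHull ℝ _) hx
    rintro _ ⟨M, hM, rfl⟩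
    exact delete_pm_incVec hM
  obtain ⟨f0, hf0⟩ := hD.2.1
  obtain ⟨M0, hM0, -⟩ := hD.2.2 f0 hf0
  have hx0 := hsub (incVecR_mem hM0)
  refine ⟨⟨_, hx0⟩, ?_⟩
  obtain ⟨M1, hM1, he1⟩ := hBrace.1.2.2 e he
  have hz := vsub_mem_vectorSpan ℝ (incVecR_mem hM1) hx0.1
  have hrank := finrank_inf_ker_s14 (vectorSpan ℝ (pmPolytope G)) (LinearMap.proj e) hz
    (by
      have h0 := hx0.2
      have h1 : incVecR G M1 e = 1 := by simp [incVecR, he1]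
      rw [vsub_eq_sub, LinearMap.proj_apply, Pi.sub_apply, h0, h1]
      norm_num)
  unfold affDim
  rw [direction_affineSpan, direction_affineSpan, ← hrank]
  suffices hsp : vectorSpan ℝ {x ∈ pmPolytope G | x e = 0} =
      vectorSpan ℝ (pmPolytope G) ⊓ LinearMap.ker (LinearMap.proj e) by rw [hsp]
  apply le_antisymm
  · refine le_inf (vectorSpan_mono ℝ (fun x hx => hx.1)) (vectorSpan_le_ker _ 0 ?_)
    rintro x ⟨hx, hxe⟩
    exact hxe
  · rintro y ⟨hy, hye⟩
    refine vectorSpan_mono ℝ hsub (mem_vectorSpan_of_kernel hD hc' (fun f hf => ?_) (fun v => ?_))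
    · by_cases hfe : f = e
      · rw [hfe]
        exact hye
      · have hfG : f ∉ G.edgeSet := by
          intro h
          apply hf
          rw [SimpleGraph.edgeSet_deleteEdges]
          exact ⟨h, hfe⟩
        exact vectorSpan_le_ker (LinearMap.proj f) 0
          (fun x hx => (mem_pmPolytope hx).2.1 f hfG) hy
    · have := vectorSpan_le_ker (∑ w, LinearMap.proj s(v, w)) 1
          (fun x hx => by simpa using (mem_pmPolytope hx).2.2 v) hy
      simpa using this

/-- in a brace other than `C₄`, the face `{x ∈ PM(G) : xₑ = 0}` is a
facet if and only if `G - e` is matching covered. -/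
theorem brace_facet_iff_deletion_matching_covered [Fintype V] [DecidableEq V]
    (G : SimpleGraph V) (hBrace : IsBrace G)
    (hC4 : ¬ Nonempty (G ≃g SimpleGraph.cycleGraph 4))
    (e : Sym2 V) (he : e ∈ G.edgeSet) :
    ({x ∈ pmPolytope G | x e = 0}.Nonempty ∧
        affDim {x ∈ pmPolytope G | x e = 0} = affDim (pmPolytope G) - 1) ↔
      MatchingCovered (G.deleteEdges {e}) := by
  exact ⟨fun h => facet_forward G hBrace hC4 e he h.1 h.2, facet_backward G hBrace e he⟩
end

section
/- Let G be a matching covered graph and let {u,v} be a 2-separation of G, i.e., G − u − v has at least two components of even cardinality. If U is an even component of G − u − v, then δ(U ∪ {u}) is a tight cut of G, i.e., every perfect matching of G contains exactly one edge of δ(U ∪ {u}). -/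
open BigOperators

variable {V : Type*}

/-- `K` is (the vertex set of) a connected component of the subgraph of `G`
induced on `S`. -/
def IsComponentOf (G : SimpleGraph V) (S : Set V) (K : Set V) : Prop :=
  ∃ c : (G.induce S).ConnectedComponent, K = Subtype.val '' c.supp

/-- A 2-separation: distinct vertices `u, v` such that `G - u - v` has at least
two components of even cardinality. -/
def Is2Separation (G : SimpleGraph V) (u v : V) : Prop :=
  u ≠ v ∧ ∃ K₁ K₂ : Set V, K₁ ≠ K₂ ∧
    IsComponentOf G ({u, v} : Set V)ᶜ K₁ ∧ IsComponentOf G ({u, v} : Set V)ᶜ K₂ ∧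
    Even K₁.ncard ∧ Even K₂.ncard

lemma even_of_involution [Fintype V] (S : Set V) (f : V → V)
    (hf : ∀ x, f (f x) = x) (hne : ∀ x, f x ≠ x) (hS : ∀ x ∈ S, f x ∈ S) :
    Even S.ncard := by
  classical
  rw [Set.ncard_eq_toFinset_card']
  have h : ∑ x ∈ S.toFinset, (1 : ZMod 2) = 0 := by
    refine Finset.sum_involution (fun x _ => f x) ?_ ?_ ?_ ?_
    · intro x _; decide
    · intro x _ _; exact hne x
    · intro x hx; simpa using hS x (by simpa using hx)
    · intro x _; exact hf x
  rw [Finset.sum_const, nsmul_eq_mul, mul_one] at h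
  exact (ZMod.natCast_eq_zero_iff_even).1 h

lemma component_closed (G : SimpleGraph V) (S U : Set V) (hU : IsComponentOf G S U)
    (a b : V) (ha : a ∈ U) (hb : b ∈ S) (hab : G.Adj a b) : b ∈ U := by
  obtain ⟨c, rfl⟩ := hU
  obtain ⟨a', ha', rfl⟩ := ha
  refine ⟨⟨b, hb⟩, ?_, rfl⟩
  exact c.mem_supp_of_adj_mem_supp ha' (by simpa using hab)

/-- the cut `δ(U ∪ {u})` arising from a 2-separation `{u, v}` and an
even component `U` of `G - u - v` is tight. -/
theorem two_separation_cut_is_tight [Fintype V] (G : SimpleGraph V)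
    (hG : MatchingCovered G) (u v : V) (h2 : Is2Separation G u v)
    (U : Set V) (hU : IsComponentOf G ({u, v} : Set V)ᶜ U)
    (heven : Even U.ncard) :
    ∀ M : G.Subgraph, M.IsPerfectMatching →
      (M.edgeSet ∩ cutSet G (U ∪ {u})).ncard = 1 := by
  intro M hM
  have huv : u ≠ v := h2.1
  have hsub : ∀ a ∈ U, a ≠ u ∧ a ≠ v := by
    intro a ha
    obtain ⟨c, rfl⟩ := hU
    obtain ⟨a', -, rfl⟩ := ha
    have h : ¬ ((a' : V) = u ∨ (a' : V) = v) := a'.2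
    exact not_or.1 h
  have hcl : ∀ a b, a ∈ U → b ∉ U → G.Adj a b → b = u ∨ b = v := by
    intro a b ha hb hab
    by_contra hc
    exact hb (component_closed G _ U hU a b ha (by simpa using hc) hab)
  have hex := SimpleGraph.Subgraph.isPerfectMatching_iff.1 hM
  choose f hf hfu using hex
  have hfu' : ∀ a b, M.Adj a b → b = f a := fun a b h => hfu a b h
  have hadj : ∀ a, M.Adj a (f a) := hf
  have hinv : ∀ x, f (f x) = x := fun x => (hfu' _ _ (hadj x).symm).symm
  have hne : ∀ x, f x ≠ x := fun x => (M.adj_sub (hadj x)).ne'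
  have hfcl : ∀ a ∈ U, f a ∉ U → f a = u ∨ f a = v := fun a ha hb =>
    hcl a (f a) ha hb (hadj a).adj_sub
  have huU : u ∉ U := fun h => (hsub u h).1 rfl
  have hvU : v ∉ U := fun h => (hsub v h).2 rfl
  have hodd : ∀ w ∈ U, ¬ Even (U \ {w}).ncard := by
    intro w hw h
    have := Set.ncard_sdiff_singleton_add_one hw (Set.toFinite U)
    rw [← this] at heven
    exact (Nat.even_add_one.1 heven) h
  -- the partner of one of the two vertices lies in `U` iff that of the other does
  have key : ∀ p q : V, (p = u ∧ q = v ∨ p = v ∧ q = u) → f p ∈ U → f q ∈ U := by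
    intro p q hpq hp
    by_contra hq
    have hpU : p ∉ U := by grind
    refine hodd (f p) hp (even_of_involution _ f hinv hne ?_)
    rintro x ⟨hx, hxp⟩
    have hxp' : x ≠ f p := hxp
    have h1 : f x ≠ p := fun h => hxp' (by rw [← h, hinv])
    have h2 : f x ≠ q := fun h => hq (by rw [← h, hinv]; exact hx)
    refine ⟨?_, ?_⟩
    · by_contra hc
      have := hfcl x hx hc
      grind
    · intro h
      have h3 : f x = f p := h
      have : x = p := by rw [← hinv x, h3, hinv]
      exact hpU (this ▸ hx)
  rw [Set.ncard_eq_one]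
  by_cases hu : f u ∈ U
  · have hv := key u v (Or.inl ⟨rfl, rfl⟩) hu
    refine ⟨s(f v, v), Set.eq_singleton_iff_unique_mem.2 ⟨⟨?_, ?_, f v, v, rfl, Or.inl hv, ?_⟩, ?_⟩⟩
    · exact (hadj v).symm
    · exact (hadj v).symm.adj_sub
    · rintro (h | h)
      · exact hvU h
      · exact huv h.symm
    · rintro e ⟨heM, -, a, b, rfl, ha, hb⟩
      have hab : M.Adj a b := heM
      have hbU : b ∉ U := fun h => hb (Or.inl h)
      have hbu : b ≠ u := fun h => hb (Or.inr h)
      have hbf := hfu' a b hab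
      have haf := hfu' b a hab.symm
      rcases ha with ha | ha
      · rcases hcl a b ha hbU hab.adj_sub with h | h
        · exact absurd h hbu
        · subst h; rw [haf]
      · have ha' : a = u := ha
        subst ha'
        exact absurd (hbf ▸ hu) hbU
  · have hv : f v ∉ U := fun h => hu (key v u (Or.inr ⟨rfl, rfl⟩) h)
    refine ⟨s(u, f u), Set.eq_singleton_iff_unique_mem.2 ⟨⟨hadj u, (hadj u).adj_sub, u, f u, rfl, Or.inr rfl, ?_⟩, ?_⟩⟩
    · rintro (h | h)
      · exact hu h
      · exact hne u h
    · rintro e ⟨heM, -, a, b, rfl, ha, hb⟩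
      have hab : M.Adj a b := heM
      have hbU : b ∉ U := fun h => hb (Or.inl h)
      have hbu : b ≠ u := fun h => hb (Or.inr h)
      have hbf := hfu' a b hab
      have haf := hfu' b a hab.symm
      rcases ha with ha | ha
      · rcases hcl a b ha hbU hab.adj_sub with h | h
        · exact absurd h hbu
        · subst h
          exact absurd (haf ▸ ha) hv
      · have ha' : a = u := ha
        subst ha'
        rw [hbf]
end
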